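/- arXiv:2511.15508 — 2 statements merged into one kernel-verified Lean document; each statement's English description precedes it below -/
import Mathlib

section
/- Let k ≥ 3 and n > 2k be integers and let F ⊆ \binom{[n]}{k} be an intersecting family. If d_2(F) = \binom{n-2}{k-2} + \binom{n-3}{k-2}, then there exists a 3-element set S ⊆ [n] such that F = {F ∈ \binom{[n]}{k} : |F ∩ S| ≥ 2} (i.e., F is isomorphic to the triangle family H_2). -/
open Finset

/-- The degree of `x` in the family `F`: the number of members of `F` containing `x`. -/
def degree (F : Finset (Finset ℕ)) (x : ℕ) : ℕ :=
  (F.filter fun A => x ∈ A).card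

/-- The `i`-th largest degree (1-indexed) of the family `F` on ground set `[n] = {1, …, n}`:
the `i`-th entry of the list of degrees of all `n` elements arranged in nonincreasing order. -/
def nthDegree (n : ℕ) (F : Finset (Finset ℕ)) (i : ℕ) : ℕ :=
  (((Finset.Icc 1 n).val.map (degree F)).sort (· ≥ ·)).getD (i - 1) 0

lemma sum_memberSub (U : Finset ℕ) (r : ℕ) (H : Finset (Finset ℕ))
    (hU : ∀ A ∈ H, A ⊆ U) (hr : ∀ A ∈ H, A.card = r) :
    ∑ v ∈ U, (H.memberSubfamily v).card = r * H.card := by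
  have h1 : ∀ v, (H.memberSubfamily v).card = (H.filter (fun A => v ∈ A)).card := by
    intro v
    rw [memberSubfamily, card_image_of_injOn]
    exact (erase_injOn' v).mono (by intro A hA; simpa using (mem_filter.1 hA).2)
  simp only [h1]
  have := sum_card_bipartiteAbove_eq_sum_card_bipartiteBelow (s := U) (t := H)
    (fun v A => v ∈ A)
  simp only [bipartiteAbove, bipartiteBelow] at this
  rw [this, mul_comm, ← smul_eq_mul, ← sum_const]
  apply sum_congr rfl
  intro A hA
  rw [← hr A hA]
  congr 1
  ext v
  simp only [mem_filter, and_iff_right_iff_imp]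
  exact fun h => hU A hA h

lemma mem_le_nonMem (H K : Finset (Finset ℕ)) (hKH : ∀ A ∈ K, ∀ a ∈ A, A.erase a ∈ H) (v : ℕ) :
    (K.memberSubfamily v).card + (H.memberSubfamily v).card ≤ H.card := by
  rw [← card_memberSubfamily_add_card_nonMemberSubfamily v H, add_comm]
  gcongr
  intro A hA
  rw [mem_memberSubfamily] at hA
  rw [mem_nonMemberSubfamily]
  refine ⟨?_, hA.2⟩
  have := hKH _ hA.1 v (mem_insert_self _ _)
  rwa [erase_insert hA.2] at this

lemma link_shadow (H K : Finset (Finset ℕ)) (hKH : ∀ A ∈ K, ∀ a ∈ A, A.erase a ∈ H) (v : ℕ) :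
    ∀ A ∈ K.memberSubfamily v, ∀ a ∈ A, A.erase a ∈ H.memberSubfamily v := by
  intro A hA a ha
  rw [mem_memberSubfamily] at hA ⊢
  have hne : a ≠ v := by rintro rfl; exact hA.2 ha
  have := hKH _ hA.1 a (mem_insert_of_mem ha)
  rw [erase_insert_of_ne hne.symm] at this
  exact ⟨this, fun h => hA.2 (mem_of_mem_erase h)⟩

lemma link_card (r : ℕ) (H : Finset (Finset ℕ)) (hr : ∀ A ∈ H, A.card = r + 1) (v : ℕ) :
    ∀ A ∈ H.memberSubfamily v, A.card = r := by
  intro A hA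
  rw [mem_memberSubfamily] at hA
  have := hr _ hA.1
  rw [card_insert_of_notMem hA.2] at this
  omega

lemma K_empty (r : ℕ) (K : Finset (Finset ℕ)) (hK : ∀ A ∈ K, A.card = r + 1)
    (hKH : ∀ A ∈ K, ∀ a ∈ A, A.erase a ∈ (∅ : Finset (Finset ℕ))) : K = ∅ := by
  by_contra h
  obtain ⟨A, hA⟩ := nonempty_iff_ne_empty.2 h
  have : A.Nonempty := by rw [← card_pos, hK A hA]; omega
  obtain ⟨a, ha⟩ := this
  exact absurd (hKH A hA a ha) (notMem_empty _)

def supp (H K : Finset (Finset ℕ)) : Finset ℕ := H.biUnion id ∪ K.biUnion id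

lemma supp_H (H K : Finset (Finset ℕ)) : ∀ A ∈ H, A ⊆ supp H K := by
  intro A hA a ha
  simp only [supp, mem_union, mem_biUnion, id]
  exact Or.inl ⟨A, hA, ha⟩

lemma supp_K (H K : Finset (Finset ℕ)) : ∀ A ∈ K, A ⊆ supp H K := by
  intro A hA a ha
  simp only [supp, mem_union, mem_biUnion, id]
  exact Or.inr ⟨A, hA, ha⟩

/-- Kruskal-Katona type inequality. -/
lemma kk (r : ℕ) : ∀ (b : ℕ) (H K : Finset (Finset ℕ)), (∀ A ∈ H, A.card = r) →
    (∀ A ∈ K, A.card = r + 1) → (∀ A ∈ K, ∀ a ∈ A, A.erase a ∈ H) →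
    (1 ≤ r ∨ H = ∅) → H.card ≤ b.choose r → (r + 1) * K.card + r * H.card ≤ b * H.card := by
  induction r with
  | zero =>
    intro b H K hH hK hKH h0 hb
    have h : H = ∅ := by simpa using h0
    subst h
    rw [K_empty 0 K hK hKH]; simp
  | succ r ih =>
    intro b H K hH hK hKH _ hb
    have key : ∀ v ∈ supp H K, (r + 1) * ((K.memberSubfamily v).card + (H.memberSubfamily v).card)
        ≤ b * (H.memberSubfamily v).card := by
      intro v _
      by_cases he : H.memberSubfamily v = ∅
      · have := K_empty r _ (link_card (r+1) K hK v) (he ▸ link_shadow H K hKH v)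
        simp [he, this]
      have hpos : 0 < (H.memberSubfamily v).card := card_pos.2 (nonempty_iff_ne_empty.2 he)
      have hle := mem_le_nonMem H K hKH v
      obtain _ | b := b
      · rw [Nat.choose_eq_zero_of_lt (by omega)] at hb; omega
      have hch := Nat.add_one_mul_choose_eq b r
      by_cases hc : b.choose r ≤ (H.memberSubfamily v).card
      · nlinarith
      · have hr1 : 1 ≤ r := by
          by_contra h
          have : r = 0 := by omega
          subst this; rw [Nat.choose_zero_right] at hc; omega
        have := ih b _ _ (link_card r H hH v) (link_card (r+1) K hK v) (link_shadow H K hKH v)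
          (Or.inl hr1) (by omega)
        nlinarith
    have hs := sum_le_sum key
    rw [← mul_sum, ← mul_sum, sum_add_distrib, sum_memberSub _ _ H (supp_H H K) hH,
      sum_memberSub _ _ K (supp_K H K) hK] at hs
    have : (r+1) * ((r + 1 + 1) * K.card + (r + 1) * H.card) ≤ (r+1) * (b * H.card) := by
      linarith
    exact Nat.le_of_mul_le_mul_left this (by omega)

lemma kk_eq (r : ℕ) : ∀ (b : ℕ) (H K : Finset (Finset ℕ)), (∀ A ∈ H, A.card = r) →
    (∀ A ∈ K, A.card = r + 1) → (∀ A ∈ K, ∀ a ∈ A, A.erase a ∈ H) →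
    1 ≤ r → H.Nonempty → H.card ≤ b.choose r → (r + 1) * K.card + r * H.card = b * H.card →
    H.card = b.choose r ∧ ∃ W : Finset ℕ, W.card = b ∧ H = powersetCard r W := by
  induction r with
  | zero => intros; omega
  | succ r ih =>
    intro b H K hH hK hKH _ hne hb heq
    have hHpos : 0 < H.card := card_pos.2 hne
    obtain _ | b := b
    · rw [Nat.choose_eq_zero_of_lt (by omega)] at hb; omega
    have hch := Nat.add_one_mul_choose_eq b r
    have key : ∀ v ∈ supp H K, (r + 1) * ((K.memberSubfamily v).card + (H.memberSubfamily v).card)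
        ≤ (b + 1) * (H.memberSubfamily v).card := by
      intro v _
      by_cases he : H.memberSubfamily v = ∅
      · have := K_empty r _ (link_card (r+1) K hK v) (he ▸ link_shadow H K hKH v)
        simp [he, this]
      have hpos : 0 < (H.memberSubfamily v).card := card_pos.2 (nonempty_iff_ne_empty.2 he)
      have hle := mem_le_nonMem H K hKH v
      by_cases hc : b.choose r ≤ (H.memberSubfamily v).card
      · nlinarith
      · have hr1 : 1 ≤ r := by
          by_contra h
          have : r = 0 := by omega
          subst this; rw [Nat.choose_zero_right] at hc; omega
        have := kk r b _ _ (link_card r H hH v) (link_card (r+1) K hK v) (link_shadow H K hKH v)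
          (Or.inl hr1) (by omega)
        nlinarith
    have hs : ∑ v ∈ supp H K, (r + 1) * ((K.memberSubfamily v).card + (H.memberSubfamily v).card)
        = ∑ v ∈ supp H K, (b + 1) * (H.memberSubfamily v).card := by
      rw [← mul_sum, ← mul_sum, sum_add_distrib, sum_memberSub _ _ H (supp_H H K) hH,
        sum_memberSub _ _ K (supp_K H K) hK, heq]
      ring
    have keq := (sum_eq_sum_iff_of_le key).1 hs
    have hdeg : ∀ v ∈ supp H K, (H.memberSubfamily v).Nonempty →
        (H.memberSubfamily v).card = b.choose r := by
      intro v hv hvne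
      have hpos : 0 < (H.memberSubfamily v).card := card_pos.2 hvne
      have e := keq v hv
      have hle := mem_le_nonMem H K hKH v
      have hle2 : (H.memberSubfamily v).card ≤ b.choose r := by
        by_contra hc
        push Not at hc
        nlinarith
      rcases Nat.eq_zero_or_pos r with h0 | h1
      · subst h0; simp at hle2 ⊢; omega
      · refine (ih b _ _ (link_card r H hH v) (link_card (r+1) K hK v) (link_shadow H K hKH v)
          h1 hvne hle2 ?_).1
        nlinarith
    set V := H.biUnion id with hV
    have hVs : V ⊆ supp H K := subset_union_left
    have hVne : ∀ v ∈ V, (H.memberSubfamily v).Nonempty := by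
      intro v hv
      simp only [hV, mem_biUnion, id] at hv
      obtain ⟨A, hA, hvA⟩ := hv
      exact ⟨A.erase v, by rw [mem_memberSubfamily, insert_erase hvA]; exact ⟨hA, by simp⟩⟩
    have hsub : ∀ A ∈ H, A ⊆ V := fun A hA a ha => by
      simp only [hV, mem_biUnion, id]; exact ⟨A, hA, ha⟩
    obtain ⟨A, hA⟩ := hne
    have : A.Nonempty := by rw [← card_pos, hH A hA]; omega
    obtain ⟨v, hvA⟩ := this
    have hvV : v ∈ V := hsub A hA hvA
    have d := hdeg v (hVs hvV) (hVne v hvV)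
    have dpos : 0 < b.choose r := by rw [← d]; exact card_pos.2 (hVne v hvV)
    have e := keq v (hVs hvV)
    have hle := mem_le_nonMem H K hKH v
    have hcard : H.card = (b+1).choose (r+1) := by
      apply le_antisymm hb
      rw [d] at e
      rw [hch, mul_comm] at e
      have := Nat.eq_of_mul_eq_mul_right (by omega) e
      rw [d] at hle
      omega
    refine ⟨hcard, V, ?_, ?_⟩
    · have hs2 := sum_memberSub V _ H hsub hH
      rw [sum_congr rfl (fun v hv => hdeg v (hVs hv) (hVne v hv)), sum_const, smul_eq_mul, hcard,
        mul_comm (r+1), ← hch] at hs2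
      exact Nat.eq_of_mul_eq_mul_right dpos hs2
    · have hs2 := sum_memberSub V _ H hsub hH
      rw [sum_congr rfl (fun v hv => hdeg v (hVs hv) (hVne v hv)), sum_const, smul_eq_mul, hcard,
        mul_comm (r+1), ← hch] at hs2
      have hVc := Nat.eq_of_mul_eq_mul_right dpos hs2
      apply eq_of_subset_of_card_le
      · intro A hA
        exact mem_powersetCard.2 ⟨hsub A hA, hH A hA⟩
      · rw [card_powersetCard, hVc, hcard]

def cliques (U : Finset ℕ) (l : ℕ) (G : Finset (Finset ℕ)) (j : ℕ) : Finset (Finset ℕ) :=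
  (powersetCard j U).filter fun A => ∀ B ∈ powersetCard l A, B ∈ G

lemma cliques_card (U : Finset ℕ) (l j : ℕ) (G : Finset (Finset ℕ)) :
    ∀ A ∈ cliques U l G j, A.card = j := by
  intro A hA
  exact (mem_powersetCard.1 (mem_filter.1 hA).1).2

lemma cliques_shadow (U : Finset ℕ) (l j : ℕ) (G : Finset (Finset ℕ)) :
    ∀ A ∈ cliques U l G (j+1), ∀ a ∈ A, A.erase a ∈ cliques U l G j := by
  intro A hA a ha
  simp only [cliques, mem_filter, mem_powersetCard] at hA ⊢
  refine ⟨⟨(erase_subset _ _).trans hA.1.1, by rw [card_erase_of_mem ha, hA.1.2]; simp⟩, ?_⟩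
  exact fun B hB => hA.2 B ⟨hB.1.trans (erase_subset _ _), hB.2⟩

lemma choose_id (a j : ℕ) : (j + 1) * a.choose (j+1) + j * a.choose j = a * a.choose j := by
  rcases le_or_gt j a with h | h
  · have := Nat.choose_succ_right_eq a j
    obtain ⟨c, rfl⟩ := Nat.exists_eq_add_of_le h
    simp at this
    nlinarith
  · rw [Nat.choose_eq_zero_of_lt h, Nat.choose_eq_zero_of_lt (by omega)]; simp

lemma cliques_le (U : Finset ℕ) (l a : ℕ) (hl : 1 ≤ l) (G : Finset (Finset ℕ))
    (hG : G.card ≤ a.choose l) (i : ℕ) : (cliques U l G (l + i)).card ≤ a.choose (l + i) := by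
  induction i with
  | zero =>
    refine le_trans (card_le_card ?_) hG
    intro A hA
    have := cliques_card U l _ G A hA
    exact (mem_filter.1 hA).2 A (mem_powersetCard.2 ⟨Subset.rfl, this⟩)
  | succ i ih =>
    have h := kk (l+i) a _ _ (cliques_card U l (l+i) G) (cliques_card U l (l+i+1) G)
      (cliques_shadow U l (l+i) G) (Or.inl (by omega)) ih
    have hid := choose_id a (l+i)
    rw [← add_assoc]
    rcases le_or_gt (l+i) a with h' | h'
    · obtain ⟨c, hc⟩ := Nat.exists_eq_add_of_le h'
      have h1 : (l+i+1) * (cliques U l G (l+i+1)).card ≤ c * (cliques U l G (l+i)).card := by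
        have : a * (cliques U l G (l+i)).card = (l+i) * (cliques U l G (l+i)).card
          + c * (cliques U l G (l+i)).card := by rw [hc]; ring
        omega
      have h2 : (l+i+1) * a.choose (l+i+1) = c * a.choose (l+i) := by
        have : a * a.choose (l+i) = (l+i) * a.choose (l+i)
          + c * a.choose (l+i) := by nth_rw 1 [hc]; ring
        omega
      have h3 := Nat.mul_le_mul_left c ih
      exact Nat.le_of_mul_le_mul_left (by omega : (l+i+1) * _ ≤ (l+i+1) * _) (by omega)
    · rw [Nat.choose_eq_zero_of_lt h'] at ih
      have : (cliques U l G (l+i)).card = 0 := by omega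
      rw [this] at h
      simp at h
      simp [h]

lemma cliques_eq (U : Finset ℕ) (l a : ℕ) (hl : 1 ≤ l) (G : Finset (Finset ℕ))
    (hG : G.card ≤ a.choose l) (i : ℕ) (ha : l + i + 1 ≤ a)
    (hs : a.choose (l+i+1) ≤ (cliques U l G (l + i + 1)).card) :
    ∃ W : Finset ℕ, W.card = a ∧ G = powersetCard l W := by
  have ih := cliques_le U l a hl G hG i
  have h := kk (l+i) a _ _ (cliques_card U l (l+i) G) (cliques_card U l (l+i+1) G)
      (cliques_shadow U l (l+i) G) (Or.inl (by omega)) ih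
  have hid := choose_id a (l+i)
  obtain ⟨c, hc⟩ := Nat.exists_eq_add_of_le (by omega : l + i ≤ a)
  have h1 : a * (cliques U l G (l+i)).card = (l+i) * (cliques U l G (l+i)).card
      + c * (cliques U l G (l+i)).card := by rw [hc]; ring
  have h2 : a * a.choose (l+i) = (l+i) * a.choose (l+i)
      + c * a.choose (l+i) := by nth_rw 1 [hc]; ring
  have h3 := Nat.mul_le_mul_left c ih
  have h4 := Nat.mul_le_mul_left (l+i+1) hs
  have hne : (cliques U l G (l+i)).Nonempty := by
    by_contra hcon
    rw [not_nonempty_iff_eq_empty] at hcon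
    have := K_empty (l+i) _ (cliques_card U l (l+i+1) G) (hcon ▸ cliques_shadow U l (l+i) G)
    rw [this] at hs
    have := Nat.choose_pos ha
    simp at hs; omega
  obtain ⟨-, W, hW, hGW⟩ := kk_eq (l+i) a _ _ (cliques_card U l (l+i) G)
    (cliques_card U l (l+i+1) G) (cliques_shadow U l (l+i) G) (by omega) hne ih (by omega)
  refine ⟨W, hW, (eq_of_subset_of_card_le ?_ (by rw [card_powersetCard, hW]; exact hG)).symm⟩
  intro B hB
  rw [mem_powersetCard] at hB
  obtain ⟨C, hBC, hCW, hC⟩ := exists_subsuperset_card_eq (n := l + i) hB.1 (by omega) (by omega)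
  have : C ∈ cliques U l G (l+i) := by rw [hGW]; exact mem_powersetCard.2 ⟨hCW, hC⟩
  exact (mem_filter.1 this).2 B (mem_powersetCard.2 ⟨hBC, hB.2⟩)

lemma star_card (U : Finset ℕ) (l z : ℕ) (hz : z ∈ U) :
    ((powersetCard (l+1) U).filter (fun A => z ∈ A)).card = (U.card - 1).choose l := by
  have h := card_filter_add_card_filter_not (s := powersetCard (l+1) U) (fun A => z ∈ A)
  have h2 : (powersetCard (l+1) U).filter (fun A => ¬ z ∈ A) = powersetCard (l+1) (U.erase z) := by
    ext A
    simp only [mem_filter, mem_powersetCard, subset_erase]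
    tauto
  rw [h2, card_powersetCard, card_powersetCard, card_erase_of_mem hz] at h
  have : 0 < U.card := card_pos.2 ⟨z, hz⟩
  obtain ⟨c, hc⟩ := Nat.exists_eq_add_of_lt this
  rw [hc] at h ⊢
  simp only [zero_add, Nat.add_sub_cancel] at h ⊢
  rw [Nat.choose_succ_succ] at h
  simp only [Nat.succ_eq_add_one] at h
  omega

lemma cross (U : Finset ℕ) (l : ℕ) (hm : 2 * (l+1) < U.card) (P Q : Finset (Finset ℕ))
    (hP : P ⊆ powersetCard (l+1) U) (hQ : Q ⊆ powersetCard (l+1) U)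
    (hPQ : ∀ A ∈ P, ∀ B ∈ Q, (A ∩ B).Nonempty)
    (hPc : (U.card - 1).choose l ≤ P.card) (hQc : (U.card - 1).choose l ≤ Q.card) :
    ∃ z ∈ U, P = (powersetCard (l+1) U).filter (fun A => z ∈ A) ∧
      Q = (powersetCard (l+1) U).filter (fun A => z ∈ A) := by
  obtain ⟨i, hi⟩ := Nat.exists_eq_add_of_lt hm
  set G := powersetCard (l+1) U \ Q with hGdef
  have hG : G.card ≤ (U.card - 1).choose (l+1) := by
    have h := card_sdiff_add_card_eq_card hQ
    rw [← hGdef, card_powersetCard] at h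
    rw [hi] at h hQc ⊢
    simp only [Nat.add_sub_cancel] at hQc ⊢
    rw [Nat.choose_succ_succ] at h
    simp only [Nat.succ_eq_add_one] at h
    omega
  have hcl : ∀ A ∈ P, U \ A ∈ cliques U (l+1) G (l + 1 + i + 1) := by
    intro A hA
    have hA' := mem_powersetCard.1 (hP hA)
    simp only [cliques, mem_filter, mem_powersetCard]
    refine ⟨⟨sdiff_subset, by rw [card_sdiff_of_subset hA'.1, hA'.2, hi]; omega⟩, ?_⟩
    rintro B ⟨hB, hBc⟩
    rw [hGdef, mem_sdiff, mem_powersetCard]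
    refine ⟨⟨hB.trans sdiff_subset, hBc⟩, fun hBQ => ?_⟩
    obtain ⟨t, ht⟩ := hPQ A hA B hBQ
    rw [mem_inter] at ht
    exact (mem_sdiff.1 (hB ht.2)).2 ht.1
  have hPcl : P.card ≤ (cliques U (l+1) G (l+1+i+1)).card := by
    apply card_le_card_of_injOn (fun A => U \ A) hcl
    intro A hA B hB h
    have hA' := (mem_powersetCard.1 (hP hA)).1
    have hB' := (mem_powersetCard.1 (hP hB)).1
    simp only at h
    rw [← Finset.sdiff_sdiff_eq_self hA', ← Finset.sdiff_sdiff_eq_self hB', h]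
  obtain ⟨W, hW, hGW⟩ := cliques_eq U (l+1) (U.card - 1) (by omega) G hG i (by omega) (by
    refine le_trans (le_of_eq ?_) (hPc.trans hPcl)
    apply Nat.choose_symm_of_eq_add
    omega)
  have hWU : W ⊆ U := by
    intro w hw
    obtain ⟨C, hwC, hCW, hC⟩ := exists_subsuperset_card_eq (n := l + 1)
      (singleton_subset_iff.2 hw) (by simp) (by omega)
    have : C ∈ G := by rw [hGW]; exact mem_powersetCard.2 ⟨hCW, hC⟩
    exact (mem_powersetCard.1 (mem_sdiff.1 this).1).1 (hwC (mem_singleton_self _))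
  have h1 : (U \ W).card = 1 := by rw [card_sdiff_of_subset hWU]; omega
  obtain ⟨z, hz⟩ := card_eq_one.1 h1
  have hzU : z ∈ U \ W := by rw [hz]; simp
  rw [mem_sdiff] at hzU
  refine ⟨z, hzU.1, ?_, ?_⟩
  · apply eq_of_subset_of_card_le
    · intro A hA
      refine mem_filter.2 ⟨hP hA, ?_⟩
      by_contra hzA
      have hzc : z ∈ U \ A := mem_sdiff.2 ⟨hzU.1, hzA⟩
      have hc := hcl A hA
      have hcc := cliques_card _ _ _ _ _ hc
      obtain ⟨C, hwC, hCW, hC⟩ := exists_subsuperset_card_eq (n := l + 1)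
        (singleton_subset_iff.2 hzc) (by simp) (by omega)
      have : C ∈ G := (mem_filter.1 hc).2 C (mem_powersetCard.2 ⟨hCW, hC⟩)
      rw [hGW] at this
      exact hzU.2 ((mem_powersetCard.1 this).1 (hwC (mem_singleton_self _)))
    · rw [star_card U l z hzU.1]; exact hPc
  · symm
    apply eq_of_subset_of_card_le
    · intro A hA
      rw [mem_filter] at hA
      by_contra hAQ
      have : A ∈ G := mem_sdiff.2 ⟨hA.1, hAQ⟩
      rw [hGW] at this
      exact hzU.2 ((mem_powersetCard.1 this).1 hA.2)
    · rw [star_card U l z hzU.1]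
      have h := card_sdiff_add_card_eq_card hQ
      have hg : G.card = (U.card - 1).choose (l+1) := by rw [hGW, card_powersetCard, hW]
      rw [← hGdef, card_powersetCard, hg] at h
      rw [hi] at h ⊢
      simp only [Nat.add_sub_cancel] at h ⊢
      rw [Nat.choose_succ_succ] at h
      simp only [Nat.succ_eq_add_one] at h
      omega

lemma degree_eq (F : Finset (Finset ℕ)) (v : ℕ) : degree F v = (F.memberSubfamily v).card := by
  rw [memberSubfamily, card_image_of_injOn, degree]
  exact (erase_injOn' v).mono (by intro A hA; simpa using (mem_filter.1 hA).2)

lemma exists_two (n : ℕ) (hn : 2 ≤ n) (F : Finset (Finset ℕ)) :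
    ∃ x ∈ Icc 1 n, ∃ y ∈ Icc 1 n, x ≠ y ∧ nthDegree n F 2 ≤ degree F x ∧
      nthDegree n F 2 ≤ degree F y := by
  set D := nthDegree n F 2 with hD
  have hlen := Multiset.length_sort (s := (Icc 1 n).val.map (degree F)) (r := (· ≥ ·))
  have hsrt := Multiset.pairwise_sort ((Icc 1 n).val.map (degree F)) (· ≥ ·)
  have heq := Multiset.sort_eq ((Icc 1 n).val.map (degree F)) (· ≥ ·)
  rw [nthDegree] at hD
  have hcnt : 2 ≤ Multiset.countP (fun d => D ≤ d) ((Icc 1 n).val.map (degree F)) := by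
    rw [← heq]
    generalize Multiset.sort ((Icc 1 n).val.map (degree F)) (· ≥ ·) = L at *
    simp only [Multiset.card_map, card_val, Nat.card_Icc] at hlen
    match L, hlen with
    | [], h => simp at h; omega
    | [a], h => simp at h; omega
    | a :: b :: L, _ =>
      simp at hD
      have hab : b ≤ a := by
        rw [List.pairwise_cons] at hsrt
        exact hsrt.1 b (by simp)
      rw [Multiset.coe_countP, List.countP_cons_of_pos (by simp; omega),
        List.countP_cons_of_pos (by simp; omega)]
      omega
  rw [Multiset.countP_map] at hcnt
  have h2 : 1 < ((Icc 1 n).filter (fun v => D ≤ degree F v)).card := hcnt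
  obtain ⟨x, hx, y, hy, hxy⟩ := one_lt_card.1 h2
  rw [mem_filter] at hx hy
  exact ⟨x, hx.1, y, hy.1, hxy, hx.2, hy.2⟩

lemma deg_split (l : ℕ) (N : Finset ℕ) (F : Finset (Finset ℕ)) (hF : F ⊆ powersetCard (l+2) N)
    (x y : ℕ) (hxy : x ≠ y) :
    (F.memberSubfamily x).memberSubfamily y ⊆ powersetCard l ((N.erase x).erase y) ∧
    (F.memberSubfamily x).nonMemberSubfamily y ⊆ powersetCard (l+1) ((N.erase x).erase y) := by
  constructor
  · intro A hA
    rw [mem_memberSubfamily, mem_memberSubfamily] at hA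
    have h := mem_powersetCard.1 (hF hA.1.1)
    rw [card_insert_of_notMem hA.1.2, card_insert_of_notMem hA.2] at h
    refine mem_powersetCard.2 ⟨?_, by omega⟩
    intro a ha
    have h1 : a ≠ y := by rintro rfl; exact hA.2 ha
    have h2 : a ≠ x := by rintro rfl; exact hA.1.2 (mem_insert_of_mem ha)
    exact mem_erase.2 ⟨h1, mem_erase.2 ⟨h2, h.1 (by simp [ha])⟩⟩
  · intro A hA
    rw [mem_nonMemberSubfamily, mem_memberSubfamily] at hA
    have h := mem_powersetCard.1 (hF hA.1.1)
    rw [card_insert_of_notMem hA.1.2] at h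
    refine mem_powersetCard.2 ⟨?_, by omega⟩
    intro a ha
    have h1 : a ≠ y := by rintro rfl; exact hA.2 ha
    have h2 : a ≠ x := by rintro rfl; exact hA.1.2 ha
    exact mem_erase.2 ⟨h1, mem_erase.2 ⟨h2, h.1 (by simp [ha])⟩⟩

theorem stmt_1 (n k : ℕ) (hk : 3 ≤ k) (hn : 2 * k < n)
    (F : Finset (Finset ℕ)) (hF : F ⊆ Finset.powersetCard k (Finset.Icc 1 n))
    (hint : ∀ A ∈ F, ∀ B ∈ F, (A ∩ B).Nonempty)
    (heq : nthDegree n F 2 = (n - 2).choose (k - 2) + (n - 3).choose (k - 2)) :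
    ∃ S : Finset ℕ, S ⊆ Finset.Icc 1 n ∧ S.card = 3 ∧
      F = (Finset.powersetCard k (Finset.Icc 1 n)).filter fun A => 2 ≤ (A ∩ S).card := by
  obtain ⟨x, hx, y, hy, hxy, dx, dy⟩ := exists_two n (by omega) F
  rw [heq] at dx dy
  obtain ⟨l, rfl⟩ : ∃ l, k = l + 2 := ⟨k - 2, by omega⟩
  simp only [Nat.add_sub_cancel] at dx dy
  set N := Icc 1 n with hN
  have hNc : N.card = n := by simp [hN]
  set U := (N.erase x).erase y with hU
  have hUc : U.card = n - 2 := by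
    rw [hU, card_erase_of_mem (mem_erase.2 ⟨hxy.symm, hy⟩), card_erase_of_mem hx, hNc]; omega
  have hU' : (N.erase y).erase x = U := erase_right_comm
  have hsx := deg_split l N F hF x y hxy
  have hsy := deg_split l N F hF y x hxy.symm
  rw [hU'] at hsy
  rw [degree_eq, ← card_memberSubfamily_add_card_nonMemberSubfamily y] at dx
  rw [degree_eq, ← card_memberSubfamily_add_card_nonMemberSubfamily x] at dy
  have rx := card_le_card hsx.1
  have ry := card_le_card hsy.1
  rw [card_powersetCard, hUc] at rx ry
  have e3 : n - 2 - 1 = n - 3 := by omega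
  obtain ⟨z, hz, hPz, hQz⟩ := cross U l (by omega) _ _ hsx.2 hsy.2 (by
    intro A hA B hB
    rw [mem_nonMemberSubfamily, mem_memberSubfamily] at hA hB
    obtain ⟨t, ht⟩ := hint _ hA.1.1 _ hB.1.1
    rw [mem_inter, mem_insert, mem_insert] at ht
    refine ⟨t, ?_⟩
    rw [mem_inter]
    obtain ⟨h1 | h1, h2 | h2⟩ := ht
    · exact absurd (h1.symm.trans h2) hxy
    · subst h1; exact absurd h2 hB.2
    · subst h2; exact absurd h1 hA.2
    · exact ⟨h1, h2⟩)
    (by rw [hUc, e3]; omega) (by rw [hUc, e3]; omega)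
  have hR : (F.memberSubfamily x).memberSubfamily y = powersetCard l U := by
    apply eq_of_subset_of_card_le hsx.1
    rw [hPz, star_card U l z hz, hUc, e3] at dx
    rw [card_powersetCard, hUc]
    omega
  have hzU := hz
  rw [hU, mem_erase, mem_erase] at hz
  obtain ⟨hzy, hzx, hzN⟩ := hz
  -- membership facts
  have mU : ∀ A : Finset ℕ, A ⊆ U ↔ A ⊆ N ∧ x ∉ A ∧ y ∉ A := by
    intro A; rw [hU, subset_erase, subset_erase]; tauto
  have fxy : ∀ A ∈ powersetCard (l+2) N, x ∈ A → y ∈ A → A ∈ F := by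
    intro A hA h1 h2
    rw [mem_powersetCard] at hA
    have hy' : y ∈ A.erase x := mem_erase.2 ⟨hxy.symm, h2⟩
    have : (A.erase x).erase y ∈ powersetCard l U := by
      rw [mem_powersetCard, card_erase_of_mem hy', card_erase_of_mem h1, hA.2]
      exact ⟨erase_subset_erase _ (erase_subset_erase _ hA.1), by omega⟩
    rw [← hR, mem_memberSubfamily, insert_erase hy', mem_memberSubfamily, insert_erase h1] at this
    exact this.1.1
  have fx : ∀ A ∈ powersetCard (l+2) N, x ∈ A → y ∉ A → (A ∈ F ↔ z ∈ A) := by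
    intro A hA h1 h2
    rw [mem_powersetCard] at hA
    have e : A.erase x ∈ (F.memberSubfamily x).nonMemberSubfamily y ↔ A ∈ F := by
      rw [mem_nonMemberSubfamily, mem_memberSubfamily, insert_erase h1]
      simp [h2]
    have e2 : A.erase x ∈ powersetCard (l+1) U := by
      rw [mem_powersetCard, card_erase_of_mem h1, hA.2, mU]
      refine ⟨⟨(erase_subset _ _).trans hA.1, by simp, by simp [h2]⟩, by omega⟩
    rw [← e, hPz, mem_filter, mem_erase]
    tauto
  have fy : ∀ A ∈ powersetCard (l+2) N, y ∈ A → x ∉ A → (A ∈ F ↔ z ∈ A) := by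
    intro A hA h1 h2
    rw [mem_powersetCard] at hA
    have e : A.erase y ∈ (F.memberSubfamily y).nonMemberSubfamily x ↔ A ∈ F := by
      rw [mem_nonMemberSubfamily, mem_memberSubfamily, insert_erase h1]
      simp [h2]
    have e2 : A.erase y ∈ powersetCard (l+1) U := by
      rw [mem_powersetCard, card_erase_of_mem h1, hA.2, mU]
      refine ⟨⟨(erase_subset _ _).trans hA.1, by simp [h2], by simp⟩, by omega⟩
    rw [← e, hQz, mem_filter, mem_erase]
    tauto
  -- no member of the family avoids both x and y
  have f0 : ∀ A ∈ powersetCard (l+2) N, x ∉ A → y ∉ A → A ∉ F := by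
    intro A hA h1 h2 hAF
    rw [mem_powersetCard] at hA
    have hAU : A ⊆ U := (mU A).2 ⟨hA.1, h1, h2⟩
    have hc : ((U \ A).erase z).card ≥ l := by
      have := pred_card_le_card_erase (s := U \ A) (a := z)
      rw [card_sdiff_of_subset hAU, hUc, hA.2] at this
      omega
    obtain ⟨T, hT, hTc⟩ := exists_subset_card_eq hc
    have hTU : T ⊆ U := hT.trans ((erase_subset _ _).trans sdiff_subset)
    have hT' := (mU T).1 hTU
    have hTA : ∀ t ∈ T, t ∉ A := fun t ht => (mem_sdiff.1 (mem_of_mem_erase (hT ht))).2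
    have hzT : z ∉ T := fun h => (mem_erase.1 (hT h)).1 rfl
    by_cases hzA : z ∈ A
    · have hB : insert x (insert y T) ∈ F := by
        apply fxy _ _ (by simp) (by simp)
        rw [mem_powersetCard, card_insert_of_notMem (by simp [hxy, hT'.2.1]),
          card_insert_of_notMem hT'.2.2, hTc]
        refine ⟨?_, rfl⟩
        rw [insert_subset_iff, insert_subset_iff]
        exact ⟨hx, hy, hT'.1⟩
      obtain ⟨t, ht⟩ := hint _ hAF _ hB
      rw [mem_inter, mem_insert, mem_insert] at ht
      obtain ⟨ht, rfl | rfl | h⟩ := ht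
      · exact h1 ht
      · exact h2 ht
      · exact hTA t h ht
    · have hB : insert x (insert z T) ∈ F := by
        refine (fx _ ?_ (by simp) ?_).2 (by simp)
        · rw [mem_powersetCard, card_insert_of_notMem (by simp [hzx.symm, hT'.2.1]),
            card_insert_of_notMem hzT, hTc]
          refine ⟨?_, rfl⟩
          rw [insert_subset_iff, insert_subset_iff]
          exact ⟨hx, hzN, hT'.1⟩
        · simp [hxy.symm, hzy.symm, hT'.2.2]
      obtain ⟨t, ht⟩ := hint _ hAF _ hB
      rw [mem_inter, mem_insert, mem_insert] at ht
      obtain ⟨ht, rfl | rfl | h⟩ := ht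
      · exact h1 ht
      · exact hzA ht
      · exact hTA t h ht
  refine ⟨{x, y, z}, ?_, ?_, ?_⟩
  · intro t ht
    simp only [mem_insert, mem_singleton] at ht
    rcases ht with rfl | rfl | rfl <;> assumption
  · exact card_eq_three.2 ⟨x, y, z, hxy, hzx.symm, hzy.symm, rfl⟩
  · ext A
    rw [mem_filter]
    by_cases hA : A ∈ powersetCard (l+2) N
    swap
    · exact ⟨fun h => absurd (hF h) hA, fun h => absurd h.1 hA⟩
    have hcard : (A ∩ {x, y, z}).card =
        (if x ∈ A then 1 else 0) + (if y ∈ A then 1 else 0) + (if z ∈ A then 1 else 0) := by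
      rw [inter_comm, ← filter_mem_eq_inter, card_filter, sum_insert (by simp [hxy, hzx.symm]),
        sum_insert (by simp [hzy.symm]), sum_singleton, add_assoc]
    rw [hcard]
    by_cases h1 : x ∈ A <;> by_cases h2 : y ∈ A
    · simp only [h1, h2, if_true, hA, true_and]
      exact ⟨fun _ => by omega, fun _ => fxy A hA h1 h2⟩
    · rw [fx A hA h1 h2]
      by_cases h3 : z ∈ A <;> simp [h1, h2, h3, hA]
    · rw [fy A hA h2 h1]
      by_cases h3 : z ∈ A <;> simp [h1, h2, h3, hA]
    · have := f0 A hA h1 h2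
      by_cases h3 : z ∈ A <;> simp [h1, h2, h3, this]
end

section
/- Let k ≥ 3 and n ≥ 6k − 9 be integers and let F ⊆ \binom{[n]}{k} be an intersecting family. Then the (2k+1)-th largest degree satisfies d_{2k+1}(F) ≤ \binom{n-2}{k-2}. -/
open Finset

lemma kk_card_le (V D : Finset ℕ) (A : Finset (Finset ℕ)) (a : ℕ)
    (hA : ∀ S ∈ A, S \ V = D ∧ (S ∩ V).card = a) : A.card ≤ V.card.choose a := by
  rw [← Finset.card_powersetCard]
  apply Finset.card_le_card_of_injOn (fun S => S ∩ V)
  · intro S hS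
    simp only [Finset.mem_coe, Finset.mem_powersetCard]
    exact ⟨Finset.inter_subset_right, (hA S hS).2⟩
  · intro S hS T hT h
    have h1 := (hA S hS).1
    have h2 := (hA T hT).1
    simp only at h
    rw [← Finset.sdiff_union_inter S V, ← Finset.sdiff_union_inter T V, h1, h2, h]

lemma kk_cross (V D E : Finset ℕ) (A B : Finset (Finset ℕ)) (a b s : ℕ)
    (hA : ∀ S ∈ A, S \ V = D ∧ (S ∩ V).card = a)
    (hB : ∀ S ∈ B, S \ V = E ∧ (S ∩ V).card = b)
    (hx : ∀ S ∈ A, ∀ T ∈ B, ∃ x ∈ V, x ∈ S ∧ x ∈ T)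
    (hab : a + b ≤ V.card) (hs : s ≤ a)
    (hc : (V.card - s).choose (a - s) ≤ A.card) :
    B.card + (V.card - s).choose b ≤ V.card.choose b := by
  set N := V.card with hN
  let e : Fin N → ℕ := fun i => (V.equivFin.symm i : ℕ)
  have einj : Function.Injective e := fun i j h => by
    simpa [e, Subtype.ext_iff] using h
  have emem : ∀ i, e i ∈ V := fun i => (V.equivFin.symm i).2
  have esurj : ∀ x ∈ V, ∃ i, e i = x := fun x hx => ⟨V.equivFin ⟨x, hx⟩, by simp [e]⟩
  let ψ : Finset ℕ → Finset (Fin N) := fun S => Finset.univ.filter (fun i => e i ∈ S)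
  have ψmem : ∀ S i, i ∈ ψ S ↔ e i ∈ S := fun S i => by simp [ψ]
  have ψcard : ∀ S, (ψ S).card = (S ∩ V).card := by
    intro S
    rw [← Finset.card_image_of_injective (ψ S) einj]
    congr 1
    ext x
    simp only [Finset.mem_image, ψmem, Finset.mem_inter]
    constructor
    · rintro ⟨i, hi, rfl⟩; exact ⟨hi, emem i⟩
    · rintro ⟨h1, h2⟩
      obtain ⟨i, rfl⟩ := esurj x h2
      exact ⟨i, h1, rfl⟩
  have ψinj : ∀ S T, S \ V = T \ V → ψ S = ψ T → S = T := by
    intro S T h1 h2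
    ext x
    by_cases hxV : x ∈ V
    · obtain ⟨i, rfl⟩ := esurj x hxV
      rw [← ψmem, ← ψmem, h2]
    · have := Finset.ext_iff.1 h1 x
      simpa [hxV] using this
  set A' : Finset (Finset (Fin N)) := A.image (fun S => (ψ S)ᶜ) with hA'
  set B' : Finset (Finset (Fin N)) := B.image ψ with hB'
  have cA : A'.card = A.card := by
    apply Finset.card_image_of_injOn
    intro S hS T hT h
    exact ψinj S T ((hA S hS).1.trans (hA T hT).1.symm) (compl_injective h)
  have cB : B'.card = B.card := by
    apply Finset.card_image_of_injOn
    intro S hS T hT h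
    exact ψinj S T ((hB S hS).1.trans (hB T hT).1.symm) h
  have sA : (A' : Set (Finset (Fin N))).Sized (N - a) := by
    intro X hX
    simp only [hA', Finset.coe_image, Set.mem_image, Finset.mem_coe] at hX
    obtain ⟨S, hS, rfl⟩ := hX
    rw [Finset.card_compl, ψcard, (hA S hS).2, Fintype.card_fin]
  have e1 : (N - s).choose (N - a) = (N - s).choose (a - s) := by
    rw [← Nat.choose_symm_of_eq_add (n := N - s) (a := a - s) (b := N - a)]
    omega
  have KK := Finset.kruskal_katona_lovasz_form (i := N - a - b) (r := N - a) (k := N - s) (n := N)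
    (𝒜 := A') (by omega) (by omega) (by omega) sA (by rw [cA, e1]; exact hc)
  rw [show N - a - (N - a - b) = b by omega] at KK
  have hdisj : Disjoint B' (Finset.shadow^[N - a - b] A') := by
    rw [Finset.disjoint_left]
    intro X hX hX'
    obtain ⟨T, hT, rfl⟩ := Finset.mem_image.1 hX
    rw [Finset.mem_shadow_iterate_iff_exists_card] at hX'
    obtain ⟨u, -, -, hu⟩ := hX'
    obtain ⟨S, hS, h⟩ := Finset.mem_image.1 hu
    obtain ⟨x, hxV, hxS, hxT⟩ := hx S hS T hT
    obtain ⟨i, rfl⟩ := esurj x hxV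
    have h1 : i ∈ ψ T ∪ u := Finset.mem_union_left _ ((ψmem _ _).2 hxT)
    rw [← h, Finset.mem_compl, ψmem] at h1
    exact h1 hxS
  have hsub : B' ∪ (Finset.shadow^[N - a - b] A') ⊆ Finset.powersetCard b Finset.univ := by
    intro X hX
    rw [Finset.mem_powersetCard]
    refine ⟨Finset.subset_univ _, ?_⟩
    rcases Finset.mem_union.1 hX with h | h
    · obtain ⟨T, hT, rfl⟩ := Finset.mem_image.1 h
      rw [ψcard, (hB T hT).2]
    · have := Set.Sized.shadow_iterate (k := N - a - b) sA h
      omega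
  have := Finset.card_le_card hsub
  rw [Finset.card_union_of_disjoint hdisj, Finset.card_powersetCard, cB, Finset.card_fin] at this
  omega

/-- walk condition -/
def WW (V S : Finset ℕ) (i : ℕ) : Prop :=
  ∃ j, (V.filter (· < j)).card + i ≤ 2 * (S.filter (· < j)).card

lemma WW_lt (V S : Finset ℕ) (i : ℕ) (hS : S ⊆ V) (h : WW V S i) : i ≤ S.card := by
  obtain ⟨j, hj⟩ := h
  have h1 := Finset.card_le_card (Finset.filter_subset_filter (· < j) hS)
  have h2 := Finset.card_le_card (Finset.filter_subset (· < j) S)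
  omega

lemma WW_out (a : ℕ) (s S : Finset ℕ) (i : ℕ) (ha : ∀ x ∈ s, a < x) (hS : S ⊆ s)
    (h : WW (insert a s) S (i + 1)) : WW s S (i + 2) := by
  obtain ⟨j, hj⟩ := h
  refine ⟨j, ?_⟩
  have has : a ∉ s := fun h => lt_irrefl _ (ha a h)
  by_cases haj : a < j
  · rw [Finset.filter_insert, if_pos haj, Finset.card_insert_of_notMem (by simp [has])] at hj
    omega
  · have : S.filter (· < j) = ∅ := by
      apply Finset.filter_eq_empty_iff.2
      intro x hx
      have := ha x (hS hx)
      omega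
    rw [this] at hj
    simp at hj

lemma WW_in (a : ℕ) (s S : Finset ℕ) (i : ℕ) (ha : ∀ x ∈ s, a < x) (hS : S ⊆ s)
    (h : WW (insert a s) (insert a S) (i + 1)) : WW s S i := by
  obtain ⟨j, hj⟩ := h
  refine ⟨j, ?_⟩
  have has : a ∉ s := fun h => lt_irrefl _ (ha a h)
  have haS : a ∉ S := fun h => has (hS h)
  by_cases haj : a < j
  · rw [Finset.filter_insert, if_pos haj, Finset.card_insert_of_notMem (by simp [has]),
      Finset.filter_insert, if_pos haj, Finset.card_insert_of_notMem (by simp [haS])] at hj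
    omega
  · have h1 : S.filter (· < j) = ∅ := by
      apply Finset.filter_eq_empty_iff.2
      intro x hx
      have := ha x (hS hx)
      omega
    rw [Finset.filter_insert, Finset.filter_insert, if_neg haj, if_neg haj, h1] at hj
    simp at hj

lemma WW_count (V : Finset ℕ) : ∀ (A : Finset (Finset ℕ)) (i r : ℕ),
    (∀ S ∈ A, S ⊆ V ∧ S.card = i + r ∧ WW V S i) → A.card ≤ V.card.choose r := by
  induction V using Finset.induction_on_min with
  | empty =>
    intro A i r h
    have : A ⊆ {∅} := by
      intro S hS
      simpa using (h S hS).1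
    rcases Finset.subset_singleton_iff.1 this with h0 | h0
    · simp [h0]
    · have := (h ∅ (by simp [h0])).2.1
      have hr : r = 0 := by simp at this; omega
      simp [h0, hr]
  | insert a s ha ih =>
    intro A i r h
    have has : a ∉ s := fun h => lt_irrefl _ (ha a h)
    rcases i with _ | i
    · refine kk_card_le (insert a s) ∅ A r ?_
      intro S hS
      obtain ⟨h1, h2, -⟩ := h S hS
      exact ⟨Finset.sdiff_eq_empty_iff_subset.2 h1, by
        rw [Finset.inter_eq_left.2 h1]; omega⟩
    rw [Finset.card_insert_of_notMem has,
      ← Finset.card_filter_add_card_filter_not (s := A) (fun S => a ∈ S)]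
    have h1 : (A.filter (fun S => a ∈ S)).card ≤ s.card.choose r := by
      have : ((A.filter (fun S => a ∈ S)).image (fun S => S.erase a)).card
          = (A.filter (fun S => a ∈ S)).card := by
        apply Finset.card_image_of_injOn
        intro S hS T hT hST
        simp only [Finset.coe_filter, Set.mem_ofPred_eq] at hS hT
        simp only at hST
        rw [← Finset.insert_erase hS.2, ← Finset.insert_erase hT.2, hST]
      rw [← this]
      apply ih _ i r
      intro X hX
      simp only [Finset.mem_image, Finset.mem_filter] at hX
      obtain ⟨S, ⟨hS, haS⟩, rfl⟩ := hX
      obtain ⟨h1, h2, h3⟩ := h S hS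
      have hsub : S.erase a ⊆ s := by
        intro x hx
        have := h1 (Finset.mem_of_mem_erase hx)
        rcases Finset.mem_insert.1 this with h | h
        · exact absurd h (Finset.ne_of_mem_erase hx)
        · exact h
      refine ⟨hsub, by rw [Finset.card_erase_of_mem haS]; omega, ?_⟩
      apply WW_in a s _ i ha hsub
      rwa [Finset.insert_erase haS]
    have h2 : ∀ S ∈ A.filter (fun S => ¬ a ∈ S), S ⊆ s ∧ S.card = i + 1 + r ∧ WW s S (i + 2) := by
      intro S hS
      rw [Finset.mem_filter] at hS
      obtain ⟨h1, h2, h3⟩ := h S hS.1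
      have hsub : S ⊆ s := (Finset.subset_insert_iff_of_notMem hS.2).1 h1
      exact ⟨hsub, h2, WW_out a s S i ha hsub h3⟩
    rcases r with _ | r
    · have : A.filter (fun S => ¬ a ∈ S) = ∅ := by
        apply Finset.eq_empty_of_forall_notMem
        intro S hS
        obtain ⟨h3, h4, h5⟩ := h2 S hS
        have := WW_lt _ _ _ h3 h5
        omega
      rw [this]
      simpa using h1
    · have h3 := ih (A.filter (fun S => ¬ a ∈ S)) (i + 2) r (fun S hS => by
        obtain ⟨h3, h4, h5⟩ := h2 S hS
        exact ⟨h3, by omega, h5⟩)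
      rw [Nat.choose_succ_succ, Nat.succ_eq_add_one]
      omega

/-- left-shifted inside `V` -/
def LS (V : Finset ℕ) (A : Finset (Finset ℕ)) : Prop :=
  ∀ S ∈ A, ∀ x ∈ V, ∀ y ∈ V, x < y → y ∈ S → x ∉ S → insert x (S.erase y) ∈ A

lemma LS_cross (V : Finset ℕ) (A B : Finset (Finset ℕ)) (hB : LS V B)
    (hAV : ∀ S ∈ A, S ⊆ V) (hBV : ∀ S ∈ B, S ⊆ V)
    (hx : ∀ S ∈ A, ∀ T ∈ B, ∃ x ∈ V, x ∈ S ∧ x ∈ T) :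
    ∀ c : ℕ, ∀ S ∈ A, ∀ T ∈ B, (S ∩ T).card = c →
      ∃ j, (V.filter (· < j)).card + 1 ≤ (S.filter (· < j)).card + (T.filter (· < j)).card := by
  intro c
  induction c with
  | zero =>
    intro S hS T hT h
    obtain ⟨x, -, h1, h2⟩ := hx S hS T hT
    have : x ∈ S ∩ T := Finset.mem_inter.2 ⟨h1, h2⟩
    rw [Finset.card_eq_zero.1 h] at this
    simp at this
  | succ c ih =>
    intro S hS T hT h
    by_contra hcon
    push Not at hcon
    have hne : (S ∩ T).Nonempty := by
      rw [← Finset.card_pos]; omega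
    set y := (S ∩ T).min' hne with hy
    have hyST : y ∈ S ∩ T := Finset.min'_mem _ _
    obtain ⟨hyS, hyT⟩ := Finset.mem_inter.1 hyST
    have hmin : ∀ z, z ∈ S → z ∈ T → y ≤ z := fun z h1 h2 =>
      Finset.min'_le _ _ (Finset.mem_inter.2 ⟨h1, h2⟩)
    have hyV := hAV S hS hyS
    have key : ∀ j, j ≤ y → (S.filter (· < j)).card + (T.filter (· < j)).card
        = ((S ∪ T).filter (· < j)).card := by
      intro j hj
      rw [Finset.filter_union, Finset.card_union_of_disjoint]
      rw [Finset.disjoint_left]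
      intro z hz1 hz2
      rw [Finset.mem_filter] at hz1 hz2
      have := hmin z hz1.1 hz2.1
      omega
    have succ1 : ∀ X : Finset ℕ, y ∈ X → (X.filter (· < y + 1)).card = (X.filter (· < y)).card + 1 := by
      intro X hX
      rw [← Finset.card_insert_of_notMem (s := X.filter (· < y)) (a := y) (by simp)]
      congr 1
      ext z
      simp only [Finset.mem_filter, Finset.mem_insert]
      constructor
      · rintro ⟨h1, h2⟩
        by_cases h : z = y
        · exact Or.inl h
        · exact Or.inr ⟨h1, by omega⟩
      · rintro (rfl | ⟨h1, h2⟩)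
        · exact ⟨hX, by omega⟩
        · exact ⟨h1, by omega⟩
    have hlt : ((S ∪ T).filter (· < y)).card < (V.filter (· < y)).card := by
      have h1 := hcon (y + 1)
      rw [succ1 S hyS, succ1 T hyT, succ1 V hyV] at h1
      have := key y le_rfl
      omega
    obtain ⟨x, hx1, hx2⟩ := Finset.exists_mem_notMem_of_card_lt_card hlt
    rw [Finset.mem_filter] at hx1
    have hxST : x ∉ S ∪ T := fun h => hx2 (Finset.mem_filter.2 ⟨h, hx1.2⟩)
    have hxS : x ∉ S := fun h => hxST (Finset.mem_union_left _ h)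
    have hxT : x ∉ T := fun h => hxST (Finset.mem_union_right _ h)
    have hT' := hB T hT x hx1.1 y hyV hx1.2 hyT hxT
    have hcard : (S ∩ insert x (T.erase y)).card = c := by
      have : S ∩ insert x (T.erase y) = (S ∩ T).erase y := by
        rw [Finset.inter_insert_of_notMem hxS, Finset.inter_erase]
      rw [this, Finset.card_erase_of_mem hyST]; omega
    obtain ⟨j, hj⟩ := ih S hS _ hT' hcard
    have hj0 := hcon j
    by_cases hj1 : j ≤ x
    · have : ((insert x (T.erase y)).filter (· < j)).card ≤ (T.filter (· < j)).card := by
        apply Finset.card_le_card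
        intro z hz
        simp only [Finset.mem_filter, Finset.mem_insert, Finset.mem_erase] at hz ⊢
        refine ⟨?_, hz.2⟩
        rcases hz.1 with h | h
        · omega
        · exact h.2
      omega
    by_cases hj2 : j ≤ y
    · have h1 : ((insert x (T.erase y)).filter (· < j)).card ≤ (T.filter (· < j)).card + 1 := by
        rw [← Finset.card_insert_of_notMem (s := T.filter (· < j)) (a := x) (by simp [hxT])]
        apply Finset.card_le_card
        intro z hz
        simp only [Finset.mem_filter, Finset.mem_insert, Finset.mem_erase] at hz ⊢
        tauto
      have h2 : ((S ∪ T).filter (· < j)).card < (V.filter (· < j)).card := by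
        apply Finset.card_lt_card
        rw [Finset.ssubset_iff_of_subset]
        · exact ⟨x, by simp [hx1.1]; omega, fun h => hxST (Finset.mem_filter.1 h).1⟩
        · exact Finset.filter_subset_filter _ (Finset.union_subset (hAV S hS) (hBV T hT))
      have := key j hj2
      omega
    · have : ((insert x (T.erase y)).filter (· < j)).card = (T.filter (· < j)).card := by
        have e1 : (insert x (T.erase y)).filter (· < j) = insert x ((T.filter (· < j)).erase y) := by
          ext z
          simp only [Finset.mem_filter, Finset.mem_insert, Finset.mem_erase]
          constructor
          · tauto
          · rintro (rfl | h)
            · exact ⟨Or.inl rfl, by omega⟩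
            · tauto
        rw [e1, Finset.card_insert_of_notMem (by simp [hxT]), Finset.card_erase_of_mem
          (by simp [hyT]; omega)]
        have : 0 < (T.filter (· < j)).card := Finset.card_pos.2 ⟨y, by simp [hyT]; omega⟩
        omega
      omega

lemma nums (K m : ℕ) (hm : 6 * K + 3 ≤ m) :
    (m+2).choose (K+1) = (m+1).choose K + (m+1).choose (K+1) ∧
    (m+1).choose (K+1) = m.choose K + m.choose (K+1) ∧
    (m+1).choose K ≤ (m+2).choose K ∧ m.choose K ≤ (m+1).choose K ∧
    5 * (m+2).choose K ≤ (m+2).choose (K+1) ∧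
    (m+3).choose (K+1) = (m+2).choose K + (m+2).choose (K+1) ∧
    (m+3).choose K ≤ 2 * (m+2).choose K ∧ (m+4).choose K ≤ 4 * (m+2).choose K ∧
    0 < (m+2).choose K ∧ 0 < (m+1).choose K := by
  have h5 : 5 * (m+2).choose K ≤ (m+2).choose (K+1) := by
    have h := Nat.choose_succ_right_eq (m+2) K
    have h2 : (m+2).choose K * (5 * (K+1)) ≤ (m+2).choose K * (m + 2 - K) :=
      Nat.mul_le_mul_left _ (by omega)
    have h3 : (5 * (m+2).choose K) * (K+1) ≤ (m+2).choose (K+1) * (K+1) := by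
      rw [h]; calc _ = (m+2).choose K * (5 * (K+1)) := by ring
        _ ≤ _ := h2
    exact Nat.le_of_mul_le_mul_right h3 (by omega)
  refine ⟨Nat.choose_succ_succ _ _, Nat.choose_succ_succ _ _, Nat.choose_le_succ _ _,
    Nat.choose_le_succ _ _, h5, Nat.choose_succ_succ _ _, ?_, ?_,
    Nat.choose_pos (by omega), Nat.choose_pos (by omega)⟩
  · rcases K with _ | K
    · simp
    · have h1 := Nat.choose_succ_succ (m+2) K
      have h2 : (m+2).choose K ≤ (m+2).choose (K+1) := Nat.choose_le_succ_of_lt_half_left (by omega)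
      simp only [Nat.succ_eq_add_one] at h1
      rw [show m + 3 = m + 2 + 1 by rfl]
      omega
  · rcases K with _ | _ | K
    · simp
    · simp; omega
    · have h1 := Nat.choose_succ_succ (m+3) (K+1)
      have h2 := Nat.choose_succ_succ (m+2) (K+1)
      have h3 := Nat.choose_succ_succ (m+2) K
      have h4 : (m+2).choose K ≤ (m+2).choose (K+1) := Nat.choose_le_succ_of_lt_half_left (by omega)
      have h5 : (m+2).choose (K+1) ≤ (m+2).choose (K+2) := Nat.choose_le_succ_of_lt_half_left (by omega)
      simp only [Nat.succ_eq_add_one] at h1 h2 h3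
      rw [show m + 4 = m + 3 + 1 by rfl]
      rw [show m + 3 = m + 2 + 1 by rfl] at *
      rw [show K + 1 + 1 = K + 2 by rfl] at *
      omega

/-- pairs of cross-intersecting families of `r`-subsets of `V` -/
structure CI (V : Finset ℕ) (r : ℕ) (A B : Finset (Finset ℕ)) : Prop where
  hA : ∀ S ∈ A, S ⊆ V ∧ S.card = r
  hB : ∀ S ∈ B, S ⊆ V ∧ S.card = r
  hx : ∀ S ∈ A, ∀ T ∈ B, ∃ x, x ∈ S ∧ x ∈ T

lemma CI.symm {V : Finset ℕ} {r : ℕ} {A B : Finset (Finset ℕ)} (h : CI V r A B) : CI V r B A :=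
  ⟨h.hB, h.hA, fun S hS T hT => by
    obtain ⟨x, h1, h2⟩ := h.hx T hT S hS
    exact ⟨x, h2, h1⟩⟩

lemma boot1 {V : Finset ℕ} {K m : ℕ} {A B : Finset (Finset ℕ)} (hm : 6 * K + 3 ≤ m)
    (hV : V.card = m + 4) (h : CI V (K+2) A B) (hb : (m+1).choose (K+1) < B.card)
    (z : ℕ) (hz : z ∈ V) (hbz : (B.filter (fun S => z ∉ S)).card ≤ 2 * (m+2).choose K) :
    (A.filter (fun S => z ∉ S)).card < (m+1).choose K := by
  by_contra hcon
  push Not at hcon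
  have hVc : (V.erase z).card = m + 3 := by rw [Finset.card_erase_of_mem hz]; omega
  have := kk_cross (V.erase z) ∅ {z} (A.filter (fun S => z ∉ S)) (B.filter (fun S => z ∈ S))
    (K+2) (K+1) 2 ?_ ?_ ?_ (by omega) (by omega) (by rw [hVc]; exact hcon)
  · rw [hVc] at this
    rw [show m + 3 - 2 = m + 1 by omega] at this
    have h2 := Finset.card_filter_add_card_filter_not (s := B) (fun S => z ∈ S)
    obtain ⟨n1, n2, n3, n4, n5, n6, n7, n8, n9, n10⟩ := nums K m hm
    omega
  · intro S hS
    rw [Finset.mem_filter] at hS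
    obtain ⟨h1, h2⟩ := h.hA S hS.1
    have : S ⊆ V.erase z := Finset.subset_erase.2 ⟨h1, hS.2⟩
    exact ⟨Finset.sdiff_eq_empty_iff_subset.2 this, by rw [Finset.inter_eq_left.2 this, h2]⟩
  · intro S hS
    rw [Finset.mem_filter] at hS
    obtain ⟨h1, h2⟩ := h.hB S hS.1
    constructor
    · ext x
      simp only [Finset.mem_sdiff, Finset.mem_erase, Finset.mem_singleton]
      constructor
      · rintro ⟨h3, h4⟩
        by_contra h5
        exact h4 ⟨h5, h1 h3⟩
      · rintro rfl
        exact ⟨hS.2, by simp⟩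
    · rw [Finset.inter_erase, Finset.inter_eq_left.2 h1, Finset.card_erase_of_mem hS.2]; omega
  · intro S hS T hT
    rw [Finset.mem_filter] at hS hT
    obtain ⟨x, h1, h2⟩ := h.hx S hS.1 T hT.1
    refine ⟨x, Finset.mem_erase.2 ⟨?_, (h.hA S hS.1).1 h1⟩, h1, h2⟩
    rintro rfl
    exact hS.2 h1

/-- one half of the shifted case -/
lemma base1 {V : Finset ℕ} {K m : ℕ} {A B : Finset (Finset ℕ)} (hm : 6 * K + 3 ≤ m)
    (hV : V.card = m + 4) (h : CI V (K+2) A B) (ha : (m+1).choose (K+1) < A.card)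
    (hBs : LS V B) (z : ℕ) (hz : z ∈ V) (hzm : ∀ x ∈ V, z ≤ x) :
    (B.filter (fun S => z ∉ S)).card ≤ 2 * (m+2).choose K := by
  obtain ⟨n1, n2, n3, n4, n5, n6, n7, n8, n9, n10⟩ := nums K m hm
  have h1 : ∃ S ∈ A, ¬ WW V S 2 := by
    by_contra hcon
    push Not at hcon
    have := WW_count V A 2 K (fun S hS => ⟨(h.hA S hS).1, by rw [(h.hA S hS).2]; omega, hcon S hS⟩)
    rw [hV] at this
    omega
  obtain ⟨S, hS, hSW⟩ := h1
  have hW : ∀ T ∈ B, WW V T 1 := by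
    intro T hT
    obtain ⟨j, hj⟩ := LS_cross V A B hBs (fun S hS => (h.hA S hS).1) (fun S hS => (h.hB S hS).1)
      (fun S hS T hT => by
        obtain ⟨x, h1, h2⟩ := h.hx S hS T hT
        exact ⟨x, (h.hA S hS).1 h1, h1, h2⟩) _ S hS T hT rfl
    refine ⟨j, ?_⟩
    have : ¬ ((V.filter (· < j)).card + 2 ≤ 2 * (S.filter (· < j)).card) := fun h => hSW ⟨j, h⟩
    omega
  have := WW_count (V.erase z) (B.filter (fun S => z ∉ S)) 2 K ?_
  · rw [Finset.card_erase_of_mem hz, hV] at this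
    exact le_trans this n7
  · intro T hT
    rw [Finset.mem_filter] at hT
    have h2 : T ⊆ V.erase z := Finset.subset_erase.2 ⟨(h.hB T hT.1).1, hT.2⟩
    refine ⟨h2, by rw [(h.hB T hT.1).2]; omega, ?_⟩
    apply WW_out z _ _ 0 _ h2
    · rw [Finset.insert_erase hz]; exact hW T hT.1
    · intro x hx
      rw [Finset.mem_erase] at hx
      have := hzm x hx.2
      omega

/-- shift of a set -/
def shs (x y : ℕ) (S : Finset ℕ) : Finset ℕ :=
  if y ∈ S ∧ x ∉ S then insert x (S.erase y) else S

/-- shift of a set relative to a family -/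
def shg (x y : ℕ) (A : Finset (Finset ℕ)) (S : Finset ℕ) : Finset ℕ :=
  if shs x y S ∈ A then S else shs x y S

/-- shift of a family -/
def shf (x y : ℕ) (A : Finset (Finset ℕ)) : Finset (Finset ℕ) := A.image (shg x y A)

lemma shg_spec (x y : ℕ) (A : Finset (Finset ℕ)) (S : Finset ℕ) (hS : S ∈ A) :
    (shg x y A S = S ∧ (y ∈ S → x ∉ S → insert x (S.erase y) ∈ A)) ∨
    (y ∈ S ∧ x ∉ S ∧ insert x (S.erase y) ∉ A ∧ shg x y A S = insert x (S.erase y)) := by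
  unfold shg shs
  by_cases h : y ∈ S ∧ x ∉ S
  · simp only [if_pos h]
    by_cases h2 : insert x (S.erase y) ∈ A
    · left; simp [h2]
    · right; simp [h2, h]
  · simp only [if_neg h, if_pos hS]
    left
    exact ⟨trivial, fun h1 h2 => absurd ⟨h1, h2⟩ h⟩

lemma shg_inj (x y : ℕ) (A : Finset (Finset ℕ)) : Set.InjOn (shg x y A) A := by
  intro S hS T hT h
  rw [Finset.mem_coe] at hS hT
  rcases shg_spec x y A S hS with ⟨h1, h2⟩ | ⟨h1, h2, h3, h4⟩ <;>
  rcases shg_spec x y A T hT with ⟨g1, g2⟩ | ⟨g1, g2, g3, g4⟩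
  · rw [← h1, ← g1, h]
  · rw [h1, g4] at h
    exact absurd (h ▸ hS) g3
  · rw [g1, h4] at h
    exact absurd (h ▸ hT) h3
  · rw [h4, g4] at h
    have e1 : S.erase y = T.erase y := by
      rw [← Finset.erase_insert (s := S.erase y) (a := x) (by simp [h2]), h,
        Finset.erase_insert (by simp [g2])]
    rw [← Finset.insert_erase h1, ← Finset.insert_erase g1, e1]

lemma shf_card (x y : ℕ) (A : Finset (Finset ℕ)) : (shf x y A).card = A.card :=
  Finset.card_image_of_injOn (shg_inj x y A)

lemma shf_CI {V : Finset ℕ} {r : ℕ} {A B : Finset (Finset ℕ)} (h : CI V r A B)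
    (x y : ℕ) (hxV : x ∈ V) : CI V r (shf x y A) (shf x y B) := by
  have aux : ∀ A : Finset (Finset ℕ), (∀ S ∈ A, S ⊆ V ∧ S.card = r) →
      ∀ S ∈ shf x y A, S ⊆ V ∧ S.card = r := by
    intro A hA X hX
    obtain ⟨S, hS, rfl⟩ := Finset.mem_image.1 hX
    obtain ⟨k1, k2⟩ := hA S hS
    rcases shg_spec x y A S hS with ⟨h1, h2⟩ | ⟨h1, h2, h3, h4⟩
    · rw [h1]; exact ⟨k1, k2⟩
    · rw [h4]
      refine ⟨Finset.insert_subset hxV ((Finset.erase_subset _ _).trans k1), ?_⟩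
      rw [Finset.card_insert_of_notMem (by simp [h2]), Finset.card_erase_of_mem h1]
      have : 0 < S.card := Finset.card_pos.2 ⟨y, h1⟩
      omega
  have aux2 : ∀ A B : Finset (Finset ℕ), (∀ S ∈ A, ∀ T ∈ B, ∃ x, x ∈ S ∧ x ∈ T) →
      ∀ S ∈ A, ∀ T ∈ B, (y ∈ S → x ∉ S → insert x (S.erase y) ∈ A) → y ∈ T → x ∉ T →
      ∃ w, w ∈ S ∧ w ∈ insert x (T.erase y) := by
    intro A B hc S hS T hT h1 hyT hxT
    by_cases hxS : x ∈ S
    · exact ⟨x, hxS, by simp⟩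
    by_cases hyS : y ∈ S
    · obtain ⟨w, hw1, hw2⟩ := hc _ (h1 hyS hxS) T hT
      have hwx : w ≠ x := fun e => hxT (e ▸ hw2)
      have hw3 := Finset.mem_of_mem_insert_of_ne hw1 hwx
      rw [Finset.mem_erase] at hw3
      exact ⟨w, hw3.2, by simp [hw2, hw3.1]⟩
    · obtain ⟨w, hw1, hw2⟩ := hc S hS T hT
      have : w ≠ y := fun e => hyS (e ▸ hw1)
      exact ⟨w, hw1, by simp [hw2, this]⟩
  refine ⟨aux A h.hA, aux B h.hB, ?_⟩
  intro X hX Y hY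
  obtain ⟨S, hS, rfl⟩ := Finset.mem_image.1 hX
  obtain ⟨T, hT, rfl⟩ := Finset.mem_image.1 hY
  rcases shg_spec x y A S hS with ⟨h1, h2⟩ | ⟨h1, h2, h3, h4⟩ <;>
  rcases shg_spec x y B T hT with ⟨g1, g2⟩ | ⟨g1, g2, g3, g4⟩
  · rw [h1, g1]; exact h.hx S hS T hT
  · rw [h1, g4]
    exact aux2 A B h.hx S hS T hT h2 g1 g2
  · rw [h4, g1]
    obtain ⟨w, k1, k2⟩ := aux2 B A h.symm.hx T hT S hS g2 h1 h2
    exact ⟨w, k2, k1⟩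
  · rw [h4, g4]
    exact ⟨x, by simp, by simp⟩

/-- potential -/
def pot (A : Finset (Finset ℕ)) : ℕ := ∑ S ∈ A, ∑ i ∈ S, i

lemma shg_pot (x y : ℕ) (hxy : x < y) (A : Finset (Finset ℕ)) (S : Finset ℕ) (hS : S ∈ A) :
    (∑ i ∈ shg x y A S, i) ≤ ∑ i ∈ S, i ∧
    (y ∈ S → x ∉ S → insert x (S.erase y) ∉ A → (∑ i ∈ shg x y A S, i) < ∑ i ∈ S, i) := by
  rcases shg_spec x y A S hS with ⟨h1, h2⟩ | ⟨h1, h2, h3, h4⟩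
  · rw [h1]
    exact ⟨le_rfl, fun k1 k2 k3 => absurd (h2 k1 k2) k3⟩
  · rw [h4, Finset.sum_insert (by simp [h2])]
    have := Finset.add_sum_erase S (fun i => i) h1
    exact ⟨by omega, fun _ _ _ => by omega⟩

lemma shf_pot_le (x y : ℕ) (hxy : x < y) (A : Finset (Finset ℕ)) : pot (shf x y A) ≤ pot A := by
  unfold pot shf
  rw [Finset.sum_image (shg_inj x y A)]
  exact Finset.sum_le_sum (fun S hS => (shg_pot x y hxy A S hS).1)

lemma shf_pot_lt (x y : ℕ) (hxy : x < y) (A : Finset (Finset ℕ)) (S : Finset ℕ) (hS : S ∈ A)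
    (h1 : y ∈ S) (h2 : x ∉ S) (h3 : insert x (S.erase y) ∉ A) : pot (shf x y A) < pot A := by
  unfold pot shf
  rw [Finset.sum_image (shg_inj x y A)]
  exact Finset.sum_lt_sum (fun S hS => (shg_pot x y hxy A S hS).1)
    ⟨S, hS, (shg_pot x y hxy A S hS).2 h1 h2 h3⟩

/-- an element `z ≠ x` has no larger degree after the shift -/
lemma shf_other (x y z : ℕ) (hzx : z ≠ x) (A : Finset (Finset ℕ)) :
    (A.filter (fun S => z ∉ S)).card ≤ ((shf x y A).filter (fun S => z ∉ S)).card := by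
  apply Finset.card_le_card_of_injOn (shg x y A)
  · intro S hS
    simp only [Finset.coe_filter, Set.mem_ofPred_eq] at hS ⊢
    refine ⟨Finset.mem_image_of_mem _ hS.1, ?_⟩
    rcases shg_spec x y A S hS.1 with ⟨h1, h2⟩ | ⟨h1, h2, h3, h4⟩
    · rw [h1]; exact hS.2
    · rw [h4]; simp [hzx, hS.2]
  · intro S hS T hT h
    simp only [Finset.coe_filter, Set.mem_ofPred_eq] at hS hT
    exact shg_inj x y A hS.1 hT.1 h

lemma shf_none (x y : ℕ) (A : Finset (Finset ℕ)) :
    (A.filter (fun S => x ∉ S ∧ y ∉ S)).card ≤ ((shf x y A).filter (fun S => x ∉ S)).card := by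
  apply Finset.card_le_card
  intro S hS
  rw [Finset.mem_filter] at hS ⊢
  refine ⟨?_, hS.2.1⟩
  rcases shg_spec x y A S hS.1 with ⟨h1, h2⟩ | ⟨h1, h2, h3, h4⟩
  · rw [← h1]; exact Finset.mem_image_of_mem _ hS.1
  · exact absurd h1 hS.2.2

lemma split4 (x y : ℕ) (A : Finset (Finset ℕ)) :
    A.card = (A.filter (fun S => x ∈ S ∧ y ∉ S)).card + (A.filter (fun S => y ∈ S ∧ x ∉ S)).card
      + (A.filter (fun S => x ∈ S ∧ y ∈ S)).card + (A.filter (fun S => x ∉ S ∧ y ∉ S)).card := by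
  rw [← Finset.card_filter_add_card_filter_not (s := A) (fun S => x ∈ S),
    ← Finset.card_filter_add_card_filter_not (s := A.filter (fun S => x ∈ S)) (fun S => y ∈ S),
    ← Finset.card_filter_add_card_filter_not (s := A.filter (fun S => ¬ x ∈ S)) (fun S => y ∈ S)]
  simp only [Finset.filter_filter]
  have : A.filter (fun S => y ∈ S ∧ x ∉ S) = A.filter (fun S => ¬ x ∈ S ∧ y ∈ S) :=
    Finset.filter_congr (fun S _ => and_comm)
  rw [this]
  omega

lemma split2 (x y : ℕ) (A : Finset (Finset ℕ)) :
    (A.filter (fun S => x ∉ S)).card = (A.filter (fun S => y ∈ S ∧ x ∉ S)).card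
      + (A.filter (fun S => x ∉ S ∧ y ∉ S)).card := by
  rw [← Finset.card_filter_add_card_filter_not (s := A.filter (fun S => ¬ x ∈ S)) (fun S => y ∈ S)]
  simp only [Finset.filter_filter]
  have : A.filter (fun S => y ∈ S ∧ x ∉ S) = A.filter (fun S => ¬ x ∈ S ∧ y ∈ S) :=
    Finset.filter_congr (fun S _ => and_comm)
  rw [this]

/-- traces on `V` minus two points -/
lemma trace_two {V S : Finset ℕ} {x y : ℕ} (hS : S ⊆ V) (hxS : x ∈ S) (hyS : y ∉ S) :
    S \ ((V.erase x).erase y) = {x} ∧ (S ∩ ((V.erase x).erase y)).card = S.card - 1 := by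
  constructor
  · ext w
    simp only [Finset.mem_sdiff, Finset.mem_erase, Finset.mem_singleton]
    constructor
    · rintro ⟨h3, h4⟩
      by_contra h5
      exact h4 ⟨fun e => hyS (e ▸ h3), h5, hS h3⟩
    · rintro rfl
      exact ⟨hxS, by simp⟩
  · have : S ∩ ((V.erase x).erase y) = S.erase x := by
      ext w
      simp only [Finset.mem_inter, Finset.mem_erase]
      constructor
      · tauto
      · rintro ⟨h1, h2⟩
        exact ⟨h2, fun e => hyS (e ▸ h2), h1, hS h2⟩
    rw [this, Finset.card_erase_of_mem hxS]

lemma gap1 {V : Finset ℕ} {K m : ℕ} {A B : Finset (Finset ℕ)} (hm : 6 * K + 3 ≤ m)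
    (hV : V.card = m + 4) (h : CI V (K+2) A B) (x y : ℕ) (hxV : x ∈ V) (hyV : y ∈ V) (hxy : x ≠ y)
    (ha : (m+1).choose K < (A.filter (fun S => x ∈ S ∧ y ∉ S)).card) :
    (B.filter (fun S => y ∈ S ∧ x ∉ S)).card < (m+1).choose K := by
  by_contra hcon
  push Not at hcon
  have hVc : ((V.erase x).erase y).card = m + 2 := by
    rw [Finset.card_erase_of_mem (Finset.mem_erase.2 ⟨hxy.symm, hyV⟩),
      Finset.card_erase_of_mem hxV]; omega
  have := kk_cross ((V.erase x).erase y) {y} {x} (B.filter (fun S => y ∈ S ∧ x ∉ S))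
    (A.filter (fun S => x ∈ S ∧ y ∉ S))
    (K+1) (K+1) 1 ?_ ?_ ?_ (by omega) (by omega) (by rw [hVc]; exact hcon)
  · rw [hVc] at this
    rw [show m + 2 - 1 = m + 1 by omega] at this
    obtain ⟨n1, n2, n3, n4, n5, n6, n7, n8, n9, n10⟩ := nums K m hm
    omega
  · intro S hS
    rw [Finset.mem_filter] at hS
    obtain ⟨h1, h2⟩ := h.hB S hS.1
    rw [Finset.erase_right_comm]
    have := trace_two h1 hS.2.1 hS.2.2
    rwa [h2] at this
  · intro S hS
    rw [Finset.mem_filter] at hS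
    obtain ⟨h1, h2⟩ := h.hA S hS.1
    have := trace_two h1 hS.2.1 hS.2.2
    rwa [h2] at this
  · intro S hS T hT
    rw [Finset.mem_filter] at hS hT
    obtain ⟨w, h1, h2⟩ := h.hx T hT.1 S hS.1
    refine ⟨w, ?_, h2, h1⟩
    simp only [Finset.mem_erase]
    exact ⟨fun e => hT.2.2 (e ▸ h1), fun e => hS.2.2 (e ▸ h2), (h.hA T hT.1).1 h1⟩

lemma both_le {V : Finset ℕ} {K m : ℕ} {A : Finset (Finset ℕ)} (hV : V.card = m + 4)
    (hA : ∀ S ∈ A, S ⊆ V ∧ S.card = K + 2) (x y : ℕ) (hxV : x ∈ V) (hyV : y ∈ V) (hxy : x ≠ y) :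
    (A.filter (fun S => x ∈ S ∧ y ∈ S)).card ≤ (m+2).choose K := by
  have hVc : ((V.erase x).erase y).card = m + 2 := by
    rw [Finset.card_erase_of_mem (Finset.mem_erase.2 ⟨hxy.symm, hyV⟩),
      Finset.card_erase_of_mem hxV]; omega
  rw [← hVc]
  apply kk_card_le _ {x, y}
  intro S hS
  rw [Finset.mem_filter] at hS
  obtain ⟨h1, h2⟩ := hA S hS.1
  constructor
  · ext w
    simp only [Finset.mem_sdiff, Finset.mem_erase, Finset.mem_singleton, Finset.mem_insert]
    constructor
    · rintro ⟨h3, h4⟩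
      by_contra h5
      push Not at h5
      exact h4 ⟨h5.2, h5.1, h1 h3⟩
    · rintro (rfl | rfl)
      · exact ⟨hS.2.1, by simp⟩
      · exact ⟨hS.2.2, by simp⟩
  · rw [Finset.inter_erase, Finset.inter_erase, Finset.inter_eq_left.2 h1,
      Finset.card_erase_of_mem (Finset.mem_erase.2 ⟨hxy.symm, hS.2.2⟩),
      Finset.card_erase_of_mem hS.2.1]
    omega

lemma gap2 {V : Finset ℕ} {K m : ℕ} {A B : Finset (Finset ℕ)} (hm : 6 * K + 3 ≤ m)
    (hV : V.card = m + 4) (h : CI V (K+2) A B) (x y : ℕ) (hxV : x ∈ V) (hyV : y ∈ V) (hxy : x ≠ y)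
    (ha : (m+1).choose (K+1) < A.card) (hb : (m+1).choose (K+1) < B.card)
    (ha0 : (A.filter (fun S => x ∉ S ∧ y ∉ S)).card < (m+1).choose K)
    (hb0 : (B.filter (fun S => x ∉ S ∧ y ∉ S)).card < (m+1).choose K) :
    ∃ z ∈ V, (A.filter (fun S => z ∉ S)).card < (m+1).choose K ∧
      (B.filter (fun S => z ∉ S)).card < (m+1).choose K := by
  obtain ⟨n1, n2, n3, n4, n5, n6, n7, n8, n9, n10⟩ := nums K m hm
  have sA := split4 x y A
  have sB := split4 x y B
  have dA := both_le hV h.hA x y hxV hyV hxy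
  have dB := both_le hV h.hB x y hxV hyV hxy
  have g1 := gap1 hm hV h x y hxV hyV hxy
  have g2 := gap1 hm hV h y x hyV hxV hxy.symm
  have g3 := gap1 hm hV h.symm x y hxV hyV hxy
  have g4 := gap1 hm hV h.symm y x hyV hxV hxy.symm
  have key : (A.filter (fun S => x ∉ S)).card ≤ 2 * (m+2).choose K ∧
      (B.filter (fun S => x ∉ S)).card ≤ 2 * (m+2).choose K ∨
      (A.filter (fun S => y ∉ S)).card ≤ 2 * (m+2).choose K ∧
      (B.filter (fun S => y ∉ S)).card ≤ 2 * (m+2).choose K := by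
    have q1 := split2 x y A
    have q2 := split2 x y B
    have q3 := split2 y x A
    have q4 := split2 y x B
    have e : ∀ A : Finset (Finset ℕ), A.filter (fun S => y ∉ S ∧ x ∉ S)
        = A.filter (fun S => x ∉ S ∧ y ∉ S) := fun A => Finset.filter_congr (fun S _ => and_comm)
    rw [e] at q3 q4
    by_cases c : (m+1).choose K < (A.filter (fun S => x ∈ S ∧ y ∉ S)).card
    · have := g1 c
      have := g3 (by omega)
      left; omega
    · have := g2 (by omega)
      have := g4 (by omega)
      right; omega
  rcases key with ⟨k1, k2⟩ | ⟨k1, k2⟩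
  · exact ⟨x, hxV, boot1 hm hV h hb x hxV k2, boot1 hm hV h.symm ha x hxV k1⟩
  · exact ⟨y, hyV, boot1 hm hV h hb y hyV k2, boot1 hm hV h.symm ha y hyV k1⟩

lemma stab {V : Finset ℕ} {K m : ℕ} (hm : 6 * K + 3 ≤ m) (hV : V.card = m + 4) :
    ∀ (c : ℕ) (A B : Finset (Finset ℕ)), pot A + pot B = c → CI V (K+2) A B →
    (m+1).choose (K+1) < A.card → (m+1).choose (K+1) < B.card →
    ∃ z ∈ V, (A.filter (fun S => z ∉ S)).card < (m+1).choose K ∧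
      (B.filter (fun S => z ∉ S)).card < (m+1).choose K := by
  intro c
  induction c using Nat.strong_induction_on with
  | _ c ih =>
  intro A B hc h ha hb
  by_cases hst : LS V A ∧ LS V B
  · have hne : V.Nonempty := by rw [← Finset.card_pos]; omega
    have hz := Finset.min'_mem V hne
    have hzm : ∀ x ∈ V, V.min' hne ≤ x := fun x hx => Finset.min'_le _ _ hx
    exact ⟨V.min' hne, hz,
      boot1 hm hV h hb _ hz (base1 hm hV h ha hst.2 _ hz hzm),
      boot1 hm hV h.symm ha _ hz (base1 hm hV h.symm hb hst.1 _ hz hzm)⟩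
  · have : ∃ x ∈ V, ∃ y ∈ V, x < y ∧ pot (shf x y A) + pot (shf x y B) < c := by
      rw [not_and_or] at hst
      rcases hst with h1 | h1
      · unfold LS at h1
        push Not at h1
        obtain ⟨S, hS, x, hx, y, hy, hxy, k1, k2, k3⟩ := h1
        have := shf_pot_lt x y hxy A S hS k1 k2 k3
        have := shf_pot_le x y hxy B
        exact ⟨x, hx, y, hy, hxy, by omega⟩
      · unfold LS at h1
        push Not at h1
        obtain ⟨S, hS, x, hx, y, hy, hxy, k1, k2, k3⟩ := h1
        have := shf_pot_lt x y hxy B S hS k1 k2 k3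
        have := shf_pot_le x y hxy A
        exact ⟨x, hx, y, hy, hxy, by omega⟩
    obtain ⟨x, hx, y, hy, hxy, hp⟩ := this
    obtain ⟨z, hz, z1, z2⟩ := ih _ hp (shf x y A) (shf x y B) rfl (shf_CI h x y hx)
      (by rwa [shf_card]) (by rwa [shf_card])
    by_cases hzx : z = x
    · subst hzx
      exact gap2 hm hV h z y hx hy hxy.ne ha hb (lt_of_le_of_lt (shf_none z y A) z1)
        (lt_of_le_of_lt (shf_none z y B) z2)
    · exact ⟨z, hz, lt_of_le_of_lt (shf_other x y z hzx A) z1,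
        lt_of_le_of_lt (shf_other x y z hzx B) z2⟩

lemma boot2 {V : Finset ℕ} {K m : ℕ} {A B : Finset (Finset ℕ)} (hm : 6 * K + 3 ≤ m)
    (hV : V.card = m + 4) (h : CI V (K+2) A B) (hb : (m+1).choose (K+1) < B.card)
    (z : ℕ) (hz : z ∈ V) (hbz : (B.filter (fun S => z ∉ S)).card < (m+1).choose K)
    (haz : (A.filter (fun S => z ∉ S)).card < (m+1).choose K) :
    2 * (A.filter (fun S => z ∉ S)).card ≤ (m+2).choose K := by
  obtain ⟨n1, n2, n3, n4, n5, n6, n7, n8, n9, n10⟩ := nums K m hm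
  rcases K with _ | K
  · simp only [Nat.choose_zero_right] at haz ⊢
    omega
  have hP : 2 * m.choose K ≤ (m+2).choose (K+1) := by
    have h1 := Nat.choose_succ_succ (m+1) K
    have h2 := Nat.choose_succ_succ m K
    have h3 := Nat.choose_le_succ m K
    simp only [Nat.succ_eq_add_one] at h1 h2 h3
    rw [show m + 2 = m + 1 + 1 by rfl]
    omega
  by_contra hcon
  have hVc : (V.erase z).card = m + 3 := by rw [Finset.card_erase_of_mem hz]; omega
  have := kk_cross (V.erase z) ∅ {z} (A.filter (fun S => z ∉ S)) (B.filter (fun S => z ∈ S))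
    (K+1+2) (K+1+1) 3 ?_ ?_ ?_ (by omega) (by omega)
    (by rw [hVc, show m + 3 - 3 = m by omega, show K + 1 + 2 - 3 = K by omega]; omega)
  · rw [hVc] at this
    rw [show m + 3 - 3 = m by omega] at this
    have h2 := Finset.card_filter_add_card_filter_not (s := B) (fun S => z ∈ S)
    omega
  · intro S hS
    rw [Finset.mem_filter] at hS
    obtain ⟨h1, h2⟩ := h.hA S hS.1
    have : S ⊆ V.erase z := Finset.subset_erase.2 ⟨h1, hS.2⟩
    exact ⟨Finset.sdiff_eq_empty_iff_subset.2 this, by rw [Finset.inter_eq_left.2 this, h2]⟩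
  · intro S hS
    rw [Finset.mem_filter] at hS
    obtain ⟨h1, h2⟩ := h.hB S hS.1
    constructor
    · ext x
      simp only [Finset.mem_sdiff, Finset.mem_erase, Finset.mem_singleton]
      constructor
      · rintro ⟨h3, h4⟩
        by_contra h5
        exact h4 ⟨h5, h1 h3⟩
      · rintro rfl
        exact ⟨hS.2, by simp⟩
    · rw [Finset.inter_erase, Finset.inter_eq_left.2 h1, Finset.card_erase_of_mem hS.2]; omega
  · intro S hS T hT
    rw [Finset.mem_filter] at hS hT
    obtain ⟨x, h1, h2⟩ := h.hx S hS.1 T hT.1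
    refine ⟨x, Finset.mem_erase.2 ⟨?_, (h.hA S hS.1).1 h1⟩, h1, h2⟩
    rintro rfl
    exact hS.2 h1

lemma tr {W R D S : Finset ℕ} (hS : S ⊆ W) (h : S ∩ R = D) :
    S \ (W \ R) = D ∧ (S ∩ (W \ R)).card = S.card - D.card := by
  have e1 : S \ (W \ R) = S ∩ R := by
    ext x
    have := @hS x
    simp only [Finset.mem_sdiff, Finset.mem_inter]
    tauto
  refine ⟨by rw [e1, h], ?_⟩
  have := Finset.card_sdiff_add_card_inter S (W \ R)
  rw [e1, h] at this
  omega

/-- an intersecting uniform family on `W` -/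
structure IF (W : Finset ℕ) (k : ℕ) (F : Finset (Finset ℕ)) : Prop where
  sub : ∀ S ∈ F, S ⊆ W
  card : ∀ S ∈ F, S.card = k
  int : ∀ S ∈ F, ∀ T ∈ F, ∃ x, x ∈ S ∧ x ∈ T

lemma choose_ineq (K m s : ℕ) (hm : 6 * K + 3 ≤ m) (hs : 4 ≤ s) (hs' : s ≤ K + 3) :
    (m + 4 - (s - 1)).choose (K + 3 - (s - 1)) ≤ (m + 4 - s).choose (K + 1) := by
  obtain ⟨q, hq⟩ : ∃ q, m + 4 - s = q := ⟨_, rfl⟩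
  rw [hq, show m + 4 - (s - 1) = q + 1 by omega]
  have mono : ∀ j, j ≤ K → (q+1).choose j ≤ (q+1).choose K := by
    intro j hj
    induction K, hj using Nat.le_induction with
    | base => exact le_rfl
    | succ t ht ih' =>
      clear ih'
      have : ∀ i, i ≤ t + 1 → (q+1).choose (t + 1 - i) ≤ (q+1).choose (t+1) := by
        intro i
        induction i with
        | zero => intro _; exact le_rfl
        | succ i ih =>
          intro hi
          refine le_trans ?_ (ih (by omega))
          rw [show t + 1 - i = (t + 1 - (i + 1)) + 1 by omega]
          exact Nat.choose_le_succ_of_lt_half_left (by omega)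
      have h := this (t + 1 - j) (by omega)
      rwa [show t + 1 - (t + 1 - j) = j by omega] at h
  refine le_trans (mono _ (by omega)) ?_
  obtain ⟨L, rfl⟩ : ∃ L, K = L + 1 := ⟨K - 1, by omega⟩
  have h1 := Nat.choose_succ_succ q L
  simp only [Nat.succ_eq_add_one] at h1
  have h2 : q.choose L ≤ q.choose (L+1) := Nat.choose_le_succ_of_lt_half_left (by omega)
  have h3 : 2 * q.choose (L+1) ≤ q.choose (L+1+1) := by
    have h := Nat.choose_succ_right_eq q (L+1)
    have h4 : q.choose (L+1) * (2 * (L+1+1)) ≤ q.choose (L+1) * (q - (L+1)) :=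
      Nat.mul_le_mul_left _ (by omega)
    have h5 : (2 * q.choose (L+1)) * (L+1+1) ≤ q.choose (L+1+1) * (L+1+1) := by
      rw [h]; calc _ = q.choose (L+1) * (2 * (L+1+1)) := by ring
        _ ≤ _ := h4
    exact Nat.le_of_mul_le_mul_right h5 (by omega)
  omega

lemma two_pt {W : Finset ℕ} {K m : ℕ} {F : Finset (Finset ℕ)} (hm : 6 * K + 3 ≤ m)
    (hW : W.card = m + 6) (h : IF W (K+3) F) (w y : ℕ) (hw : w ∈ W) (hy : y ∈ W) (hwy : w ≠ y)
    (hd : (m+4).choose (K+1) < (F.filter (fun S => y ∈ S)).card) :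
    (F.filter (fun S => w ∉ S ∧ y ∉ S)).card < (F.filter (fun S => y ∈ S ∧ w ∉ S)).card ∨
    (m+1).choose (K+1) < (F.filter (fun S => y ∈ S ∧ w ∉ S)).card := by
  have hVc : (W \ {w, y}).card = m + 4 := by
    rw [Finset.card_sdiff_of_subset (by intro x; simp; rintro (rfl | rfl) <;> assumption), hW,
      Finset.card_pair hwy]
    omega
  have hsum : (F.filter (fun S => y ∈ S)).card = (F.filter (fun S => w ∈ S ∧ y ∈ S)).card
      + (F.filter (fun S => y ∈ S ∧ w ∉ S)).card := by
    rw [← Finset.card_filter_add_card_filter_not (s := F.filter (fun S => y ∈ S)) (fun S => w ∈ S)]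
    simp only [Finset.filter_filter]
    have : F.filter (fun S => w ∈ S ∧ y ∈ S) = F.filter (fun S => y ∈ S ∧ w ∈ S) :=
      Finset.filter_congr (fun S _ => and_comm)
    rw [this]
  have tE : ∀ S ∈ F.filter (fun S => w ∈ S ∧ y ∈ S), S \ (W \ {w, y}) = {w, y} ∧
      (S ∩ (W \ {w, y})).card = K + 1 := by
    intro S hS
    rw [Finset.mem_filter] at hS
    have := tr (h.sub S hS.1) (R := {w, y}) (D := {w, y})
      (Finset.inter_eq_right.2 (by intro x; simp; rintro (rfl | rfl); exacts [hS.2.1, hS.2.2]))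
    rwa [h.card S hS.1, Finset.card_pair hwy] at this
  have tC : ∀ S ∈ F.filter (fun S => w ∉ S ∧ y ∉ S), S \ (W \ {w, y}) = ∅ ∧
      (S ∩ (W \ {w, y})).card = K + 3 := by
    intro S hS
    rw [Finset.mem_filter] at hS
    have := tr (h.sub S hS.1) (R := {w, y}) (D := ∅)
      (by ext x; simp; rintro h1; constructor <;> rintro rfl; exacts [hS.2.1 h1, hS.2.2 h1])
    rwa [h.card S hS.1, Finset.card_empty] at this
  have hE := kk_card_le _ _ _ _ tE
  rw [hVc] at hE
  have key : ∀ s, s ≤ K + 3 → (m + 4 - s).choose (K + 3 - s) ≤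
      (F.filter (fun S => w ∉ S ∧ y ∉ S)).card →
      (m + 4 - s).choose (K + 1) < (F.filter (fun S => y ∈ S ∧ w ∉ S)).card := by
    intro s hs hc
    have := kk_cross (W \ {w, y}) ∅ {w, y} _ _ (K+3) (K+1) s tC tE ?_ (by omega) hs
      (by rw [hVc]; exact hc)
    · rw [hVc] at this
      omega
    · intro S hS T hT
      rw [Finset.mem_filter] at hS hT
      obtain ⟨x, h1, h2⟩ := h.int S hS.1 T hT.1
      refine ⟨x, ?_, h1, h2⟩
      simp only [Finset.mem_sdiff, Finset.mem_insert, Finset.mem_singleton, not_or]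
      exact ⟨h.sub S hS.1 h1, fun e => hS.2.1 (e ▸ h1), fun e => hS.2.2 (e ▸ h1)⟩
  set c := (F.filter (fun S => w ∉ S ∧ y ∉ S)).card with hc
  by_cases h3 : (m+4-3).choose (K + 3 - 3) ≤ c
  · right; exact key 3 (by omega) h3
  left
  by_cases h0 : c = 0
  · omega
  have hex : ∃ s, 3 ≤ s ∧ (m + 4 - s).choose (K + 3 - s) ≤ c :=
    ⟨K + 3, by omega, by rw [Nat.sub_self, Nat.choose_zero_right]; omega⟩
  classical
  obtain ⟨s1, s2⟩ := Nat.find_spec hex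
  have s3 : Nat.find hex ≤ K + 3 := Nat.find_min' hex
    ⟨by omega, by rw [Nat.sub_self, Nat.choose_zero_right]; omega⟩
  set s := Nat.find hex with hs
  have s4 : s ≠ 3 := by
    intro e
    rw [e] at s2
    exact h3 s2
  have s5 : ¬ (3 ≤ s - 1 ∧ (m + 4 - (s - 1)).choose (K + 3 - (s - 1)) ≤ c) :=
    Nat.find_min hex (by omega)
  have s6 := choose_ineq K m s hm (by omega) s3
  have s7 := key s s3 s2
  have s8 : c < (m + 4 - (s - 1)).choose (K + 3 - (s - 1)) := by
    by_contra hcon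
    exact s5 ⟨by omega, by omega⟩
  omega


lemma case1 {W : Finset ℕ} {K m : ℕ} {F : Finset (Finset ℕ)} (hm : 6 * K + 3 ≤ m)
    (hW : W.card = m + 6) (h : IF W (K+3) F) (Y : Finset ℕ) (hYW : Y ⊆ W)
    (hY : 2 * (K + 3) + 1 ≤ Y.card)
    (hd : ∀ y ∈ Y, (m+4).choose (K+1) < (F.filter (fun S => y ∈ S)).card)
    (w : ℕ) (hw : w ∈ W) (hs : (F.filter (fun S => w ∉ S)).card ≤ 2 * (m+1).choose (K+1)) :
    False := by
  set G := F.filter (fun S => w ∉ S) with hG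
  have hb : ∀ y ∈ Y.erase w, G.card + 1 ≤ 2 * (G.filter (fun S => y ∈ S)).card := by
    intro y hy
    rw [Finset.mem_erase] at hy
    have h1 := two_pt hm hW h w y hw (hYW hy.2) hy.1.symm (hd y hy.2)
    have h2 := split2 w y F
    rw [← hG] at h2
    have h3 : G.filter (fun S => y ∈ S) = F.filter (fun S => y ∈ S ∧ w ∉ S) := by
      rw [hG, Finset.filter_filter]
      exact Finset.filter_congr (fun S _ => and_comm)
    rw [h3]
    omega
  have h1 := Finset.card_nsmul_le_sum (Y.erase w) (fun y => 2 * (G.filter (fun S => y ∈ S)).card)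
    (G.card + 1) hb
  rw [← Finset.mul_sum, smul_eq_mul] at h1
  have h2 : ∑ y ∈ Y.erase w, (G.filter (fun S => y ∈ S)).card ≤ G.card * (K + 3) := by
    simp only [Finset.card_filter]
    rw [Finset.sum_comm, ← smul_eq_mul]
    apply Finset.sum_le_card_nsmul
    intro S hS
    rw [← Finset.card_filter, ← h.card S (Finset.mem_filter.1 hS).1]
    apply Finset.card_le_card
    intro x hx
    exact (Finset.mem_filter.1 hx).2
  have h3 : 2 * (K + 3) ≤ (Y.erase w).card := by
    have := Finset.pred_card_le_card_erase (s := Y) (a := w)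
    omega
  have h4 : 2 * (K + 3) * (G.card + 1) ≤ (Y.erase w).card * (G.card + 1) :=
    Nat.mul_le_mul_right _ h3
  nlinarith

lemma case2 {W : Finset ℕ} {K m : ℕ} {F : Finset (Finset ℕ)} (hm : 6 * K + 3 ≤ m)
    (hW : W.card = m + 6) (h : IF W (K+3) F) (u v : ℕ) (hu : u ∈ W) (hv : v ∈ W) (huv : u ≠ v)
    (ha : (m+1).choose (K+1) < (F.filter (fun S => u ∈ S ∧ v ∉ S)).card)
    (hb : (m+1).choose (K+1) < (F.filter (fun S => v ∈ S ∧ u ∉ S)).card) :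
    ∃ z ∈ W, (F.filter (fun S => z ∉ S)).card ≤ 2 * (m+1).choose (K+1) := by
  obtain ⟨n1, n2, n3, n4, n5, n6, n7, n8, n9, n10⟩ := nums K m hm
  have hVc : (W \ {u, v}).card = m + 4 := by
    rw [Finset.card_sdiff_of_subset (by intro x; simp; rintro (rfl | rfl) <;> assumption), hW,
      Finset.card_pair huv]
    omega
  have inj : ∀ (u : ℕ) (A : Finset (Finset ℕ)), (∀ S ∈ A, u ∈ S) →
      Set.InjOn (fun S : Finset ℕ => S.erase u) A := by
    intro u A hA S hS T hT hST
    simp only at hST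
    rw [← Finset.insert_erase (hA S hS), ← Finset.insert_erase (hA T hT), hST]
  set A := F.filter (fun S => u ∈ S ∧ v ∉ S) with hA
  set B := F.filter (fun S => v ∈ S ∧ u ∉ S) with hB
  have iA : ∀ S ∈ A, u ∈ S := fun S hS => (Finset.mem_filter.1 hS).2.1
  have iB : ∀ S ∈ B, v ∈ S := fun S hS => (Finset.mem_filter.1 hS).2.1
  have cA := Finset.card_image_of_injOn (inj u A iA)
  have cB := Finset.card_image_of_injOn (inj v B iB)
  set A' := A.image (fun S => S.erase u) with hA'
  set B' := B.image (fun S => S.erase v) with hB'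
  have hCI : CI (W \ {u, v}) (K+2) A' B' := by
    refine ⟨?_, ?_, ?_⟩
    · intro X hX
      obtain ⟨S, hS, rfl⟩ := Finset.mem_image.1 hX
      obtain ⟨h1, h2, h3⟩ := Finset.mem_filter.1 hS
      refine ⟨?_, by rw [Finset.card_erase_of_mem h2, h.card S h1]; omega⟩
      intro x hx
      rw [Finset.mem_erase] at hx
      simp only [Finset.mem_sdiff, Finset.mem_insert, Finset.mem_singleton, not_or]
      exact ⟨h.sub S h1 hx.2, hx.1, fun e => h3 (e ▸ hx.2)⟩
    · intro X hX
      obtain ⟨S, hS, rfl⟩ := Finset.mem_image.1 hX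
      obtain ⟨h1, h2, h3⟩ := Finset.mem_filter.1 hS
      refine ⟨?_, by rw [Finset.card_erase_of_mem h2, h.card S h1]; omega⟩
      intro x hx
      rw [Finset.mem_erase] at hx
      simp only [Finset.mem_sdiff, Finset.mem_insert, Finset.mem_singleton, not_or]
      exact ⟨h.sub S h1 hx.2, fun e => h3 (e ▸ hx.2), hx.1⟩
    · intro X hX X' hX'
      obtain ⟨S, hS, rfl⟩ := Finset.mem_image.1 hX
      obtain ⟨T, hT, rfl⟩ := Finset.mem_image.1 hX'
      obtain ⟨h1, h2, h3⟩ := Finset.mem_filter.1 hS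
      obtain ⟨g1, g2, g3⟩ := Finset.mem_filter.1 hT
      obtain ⟨x, x1, x2⟩ := h.int S h1 T g1
      exact ⟨x, Finset.mem_erase.2 ⟨fun e => g3 (e ▸ x2), x1⟩,
        Finset.mem_erase.2 ⟨fun e => h3 (e ▸ x1), x2⟩⟩
  have ha' : (m+1).choose (K+1) < A'.card := by rw [cA]; exact ha
  have hb' : (m+1).choose (K+1) < B'.card := by rw [cB]; exact hb
  obtain ⟨z, hz, z1, z2⟩ := stab hm hVc _ A' B' rfl hCI ha' hb'
  have y1 := boot2 hm hVc hCI hb' z hz z2 z1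
  have y2 := boot2 hm hVc hCI.symm ha' z hz z1 z2
  have hz' := hz
  simp only [Finset.mem_sdiff, Finset.mem_insert, Finset.mem_singleton, not_or] at hz'
  obtain ⟨hzW, hzu, hzv⟩ := hz'
  have fz : ∀ (u : ℕ) (A : Finset (Finset ℕ)), z ≠ u → (∀ S ∈ A, u ∈ S) →
      ((A.image (fun S => S.erase u)).filter (fun S => z ∉ S)).card
        = (A.filter (fun S => z ∉ S)).card := by
    intro u A hzu hA
    rw [Finset.filter_image]
    simp only [Finset.mem_erase, hzu, ne_eq, not_false_eq_true, true_and]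
    exact Finset.card_image_of_injOn (inj u _ (fun S hS => hA S (Finset.mem_filter.1 hS).1))
  rw [fz u A hzu iA] at z1 y1
  rw [fz v B hzv iB] at z2 y2
  refine ⟨z, hzW, ?_⟩
  have h3c : ({u, v, z} : Finset ℕ).card = 3 := Finset.card_eq_three.2
    ⟨u, v, z, huv, Ne.symm hzu, Ne.symm hzv, rfl⟩
  have hV3 : (W \ {u, v, z}).card = m + 3 := by
    rw [Finset.card_sdiff_of_subset (by intro x; simp; rintro (rfl | rfl | rfl) <;> assumption), hW,
      h3c]
    omega
  have sp := split4 u v (F.filter (fun S => z ∉ S))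
  have e1 : (F.filter (fun S => z ∉ S)).filter (fun S => u ∈ S ∧ v ∉ S)
      = A.filter (fun S => z ∉ S) := Finset.filter_comm _ _ _
  have e2 : (F.filter (fun S => z ∉ S)).filter (fun S => v ∈ S ∧ u ∉ S)
      = B.filter (fun S => z ∉ S) := Finset.filter_comm _ _ _
  rw [e1, e2] at sp
  have bE : ((F.filter (fun S => z ∉ S)).filter (fun S => u ∈ S ∧ v ∈ S)).card
      ≤ (m+3).choose (K+1) := by
    rw [← hV3]
    apply kk_card_le _ {u, v}
    intro S hS
    simp only [Finset.mem_filter] at hS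
    obtain ⟨⟨h1, h2⟩, h3, h4⟩ := hS
    have := tr (h.sub S h1) (R := {u, v, z}) (D := {u, v}) (by
      ext x
      simp only [Finset.mem_inter, Finset.mem_insert, Finset.mem_singleton]
      constructor
      · rintro ⟨k1, rfl | rfl | rfl⟩
        · simp
        · simp
        · exact absurd k1 h2
      · rintro (rfl | rfl)
        · simp [h3]
        · simp [h4])
    rwa [h.card S h1, Finset.card_pair huv] at this
  have bC : ((F.filter (fun S => z ∉ S)).filter (fun S => u ∉ S ∧ v ∉ S)).card
      < m.choose K := by
    by_contra hcon
    push Not at hcon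
    have := kk_cross (W \ {u, v, z}) ∅ {u, z}
      ((F.filter (fun S => z ∉ S)).filter (fun S => u ∉ S ∧ v ∉ S)) (A.filter (fun S => z ∈ S))
      (K+3) (K+1) 3 ?_ ?_ ?_ (by omega) (by omega)
      (by rw [hV3, show m + 3 - 3 = m by omega, show K + 3 - 3 = K by omega]; exact hcon)
    · rw [hV3, show m + 3 - 3 = m by omega] at this
      have h2 := Finset.card_filter_add_card_filter_not (s := A) (fun S => z ∈ S)
      omega
    · intro S hS
      simp only [Finset.mem_filter] at hS
      obtain ⟨⟨h1, h2⟩, h3, h4⟩ := hS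
      have := tr (h.sub S h1) (R := {u, v, z}) (D := ∅) (by
        ext x
        simp only [Finset.mem_inter, Finset.mem_insert, Finset.mem_singleton, Finset.notMem_empty,
          iff_false]
        rintro ⟨k1, rfl | rfl | rfl⟩
        · exact h3 k1
        · exact h4 k1
        · exact h2 k1)
      rwa [h.card S h1, Finset.card_empty] at this
    · intro S hS
      simp only [hA, Finset.mem_filter] at hS
      obtain ⟨⟨h1, h3, h4⟩, h2⟩ := hS
      have := tr (h.sub S h1) (R := {u, v, z}) (D := {u, z}) (by
        ext x
        simp only [Finset.mem_inter, Finset.mem_insert, Finset.mem_singleton]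
        constructor
        · rintro ⟨k1, rfl | rfl | rfl⟩
          · simp
          · exact absurd k1 h4
          · simp
        · rintro (rfl | rfl)
          · simp [h3]
          · simp [h2])
      rwa [h.card S h1, Finset.card_pair (Ne.symm hzu)] at this
    · intro S hS T hT
      simp only [hA, Finset.mem_filter] at hS hT
      obtain ⟨x, x1, x2⟩ := h.int S hS.1.1 T hT.1.1
      refine ⟨x, ?_, x1, x2⟩
      simp only [Finset.mem_sdiff, Finset.mem_insert, Finset.mem_singleton, not_or]
      exact ⟨h.sub S hS.1.1 x1, fun e => hS.2.1 (e ▸ x1), fun e => hS.2.2 (e ▸ x1),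
        fun e => hS.1.2 (e ▸ x1)⟩
  omega

lemma mainY {W : Finset ℕ} {K m : ℕ} {F : Finset (Finset ℕ)} (hm : 6 * K + 3 ≤ m)
    (hW : W.card = m + 6) (h : IF W (K+3) F) (Y : Finset ℕ) (hYW : Y ⊆ W)
    (hY : 2 * (K + 3) + 1 ≤ Y.card)
    (hd : ∀ y ∈ Y, (m+4).choose (K+1) < (F.filter (fun S => y ∈ S)).card) : False := by
  have h1 := fun w hw => case1 hm hW h Y hYW hY hd w hw
  obtain ⟨u, hu, v, hv, huv⟩ := Finset.one_lt_card.1 (show 1 < Y.card by omega)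
  have big : ∀ y ∈ Y, ∀ w ∈ W, w ≠ y →
      (m+1).choose (K+1) < (F.filter (fun S => y ∈ S ∧ w ∉ S)).card := by
    intro y hy w hw hwy
    have h2 := two_pt hm hW h w y hw (hYW hy) hwy (hd y hy)
    have h3 := split2 w y F
    have h4 := h1 w hw
    by_contra hcon
    apply h4
    omega
  obtain ⟨z, hz, hz2⟩ := case2 hm hW h u v (hYW hu) (hYW hv) huv
    (big u hu v (hYW hv) huv.symm) (big v hv u (hYW hu) huv)
  exact h1 z hz hz2

lemma nth_large (n i X : ℕ) (F : Finset (Finset ℕ)) (h : X < nthDegree n F (i + 1)) :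
    i + 1 ≤ ((Finset.Icc 1 n).filter (fun y => X < degree F y)).card := by
  unfold nthDegree at h
  rw [Nat.add_sub_cancel] at h
  set M := (Finset.Icc 1 n).val.map (degree F) with hM
  set l := M.sort (· ≥ ·) with hl
  have hlen : i < l.length := by
    by_contra hcon
    rw [List.getD_eq_default _ _ (by omega)] at h
    omega
  rw [List.getD_eq_getElem _ _ hlen] at h
  have hsorted : l.Pairwise (· ≥ ·) := Multiset.pairwise_sort M (· ≥ ·)
  have hcount : ((Finset.Icc 1 n).filter (fun y => X < degree F y)).card
      = l.countP (fun d => X < d) := by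
    have e : (l : Multiset ℕ) = M := Multiset.sort_eq M (· ≥ ·)
    rw [← Multiset.coe_countP, e, hM, Multiset.countP_map]
    rfl
  rw [hcount]
  have h2 : (l.take (i+1)).countP (fun d => X < d) ≤ l.countP (fun d => X < d) :=
    (List.take_sublist _ _).countP_le
  have h3 : (l.take (i+1)).countP (fun d => X < d) = (l.take (i+1)).length := by
    rw [List.countP_eq_length]
    intro a ha
    obtain ⟨j, hj, rfl⟩ := List.mem_iff_getElem.1 ha
    rw [List.getElem_take]
    rw [List.length_take] at hj
    have : l[j] ≥ l[i] := by
      rcases Nat.lt_or_ge j i with h4 | h4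
      · exact List.pairwise_iff_getElem.1 hsorted j i _ _ h4
      · have : j = i := by omega
        subst this; exact le_rfl
    simp only [decide_eq_true_eq]
    omega
  rw [List.length_take] at h3
  omega

theorem stmt_2 (n k : ℕ) (hk : 3 ≤ k) (hn : 6 * k - 9 ≤ n)
    (F : Finset (Finset ℕ)) (hF : F ⊆ Finset.powersetCard k (Finset.Icc 1 n))
    (hint : ∀ A ∈ F, ∀ B ∈ F, (A ∩ B).Nonempty) :
    nthDegree n F (2 * k + 1) ≤ (n - 2).choose (k - 2) := by
  by_contra hcon
  push Not at hcon
  obtain ⟨K, rfl⟩ : ∃ K, k = K + 3 := ⟨k - 3, by omega⟩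
  obtain ⟨m, rfl⟩ : ∃ m, n = m + 6 := ⟨n - 6, by omega⟩
  have h1 := nth_large _ _ _ _ hcon
  refine mainY (W := Finset.Icc 1 (m + 6)) (K := K) (m := m) (F := F) (by omega) (by simp) ?_
    _ (Finset.filter_subset _ _) h1 ?_
  · refine ⟨fun S hS => (Finset.mem_powersetCard.1 (hF hS)).1,
      fun S hS => (Finset.mem_powersetCard.1 (hF hS)).2, fun S hS T hT => ?_⟩
    obtain ⟨x, hx⟩ := hint S hS T hT
    exact ⟨x, Finset.mem_inter.1 hx⟩
  · intro y hy
    exact (Finset.mem_filter.1 hy).2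
end
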